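/- arXiv:0706.0699 — 2 statements merged into one kernel-verified Lean document; each statement's English description precedes it below -/
import Mathlib

section
/- Let u ∈ C^∞(ℝⁿ \ {0}) be a solution to the special Lagrangian equation ∑_{i=1}^n arctan λᵢ(x) = c on ℝⁿ \ {0} that is homogeneous of order 2, i.e. u(x) = |x|² u(x/|x|) for all x ≠ 0. Suppose that 3 + λᵢ(x)² + 2λᵢ(x)λⱼ(x) ≥ 0 for all indices i, j and all x ≠ 0. Then u is quadratic: D²u is constant on ℝⁿ \ {0}, so u(x) = ½⟨Ax,x⟩ for a constant symmetric matrix A. -/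
noncomputable section

/-- The Hessian matrix `D²u(x)`, with entries `∂ᵢ∂ⱼ u (x)`. -/
def Hess {n : ℕ} (u : EuclideanSpace ℝ (Fin n) → ℝ) (x : EuclideanSpace ℝ (Fin n)) :
    Matrix (Fin n) (Fin n) ℝ :=
  Matrix.of fun i j =>
    iteratedFDeriv ℝ 2 u x ![EuclideanSpace.single i 1, EuclideanSpace.single j 1]

/-- The induced metric `g = I + D²u · D²u` on the gradient graph `(x, ∇u(x))`. -/
def gMat {n : ℕ} (u : EuclideanSpace ℝ (Fin n) → ℝ) (x : EuclideanSpace ℝ (Fin n)) :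
    Matrix (Fin n) (Fin n) ℝ :=
  1 + Hess u x * Hess u x

/-- The Laplace–Beltrami operator `Δ_g v = ∑ g^{ij} ∂ᵢ∂ⱼ v` of the induced metric. -/
def lapg {n : ℕ} (u v : EuclideanSpace ℝ (Fin n) → ℝ) (x : EuclideanSpace ℝ (Fin n)) : ℝ :=
  ∑ i, ∑ j, (gMat u x)⁻¹ i j *
    iteratedFDeriv ℝ 2 v x ![EuclideanSpace.single i 1, EuclideanSpace.single j 1]

/-- The squared metric gradient norm `|∇_g v|²_g = ∑ g^{ij} ∂ᵢv ∂ⱼv`. -/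
def gradSq {n : ℕ} (u v : EuclideanSpace ℝ (Fin n) → ℝ) (x : EuclideanSpace ℝ (Fin n)) : ℝ :=
  ∑ i, ∑ j, (gMat u x)⁻¹ i j * fderiv ℝ v x (EuclideanSpace.single i 1) *
    fderiv ℝ v x (EuclideanSpace.single j 1)

/-- The volume element `V = √(det g)`. -/
def Vol {n : ℕ} (u : EuclideanSpace ℝ (Fin n) → ℝ) (x : EuclideanSpace ℝ (Fin n)) : ℝ :=
  Real.sqrt ((gMat u x).det)

end


open Matrix in
lemma jacobi_det {n : ℕ} {A A' : ℝ → Matrix (Fin n) (Fin n) ℂ} {t : ℝ}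
    (h : ∀ i j, HasDerivAt (fun s => A s i j) (A' t i j) t) :
    HasDerivAt (fun s => (A s).det) ((A t).adjugate * A' t).trace t := by
  have h1 : HasDerivAt (fun s => (A s).det)
      (∑ σ : Equiv.Perm (Fin n), ((Equiv.Perm.sign σ : ℤ) : ℂ) *
        ∑ i, (∏ j ∈ Finset.univ.erase i, A t (σ j) j) • A' t (σ i) i) t := by
    simp_rw [Matrix.det_apply']
    apply HasDerivAt.fun_sum
    intro σ _
    apply HasDerivAt.const_mul
    exact HasDerivAt.fun_finsetProd (fun i _ => h (σ i) i)
  convert! h1 using 1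
  have h2 : ∀ i, ((A t).adjugate * A' t) i i = ((A t).updateCol i (fun k => A' t k i)).det := by
    intro i
    rw [← Matrix.cramer_apply, Matrix.cramer_eq_adjugate_mulVec]
    simp [Matrix.mul_apply, Matrix.mulVec, dotProduct]
  simp only [Matrix.trace, Matrix.diag, h2, Matrix.det_apply']
  rw [Finset.sum_comm]
  refine Finset.sum_congr rfl fun σ _ => ?_
  rw [Finset.mul_sum]
  refine Finset.sum_congr rfl fun i _ => ?_
  congr 1
  rw [← Finset.mul_prod_erase _ _ (Finset.mem_univ i)]
  rw [smul_eq_mul, mul_comm]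
  congr 1
  · refine Finset.prod_congr rfl fun j hj => ?_
    rw [Matrix.updateCol_ne (Finset.ne_of_mem_erase hj)]
  · simp

lemma diff_inv_entry {n : ℕ} {A : ℝ → Matrix (Fin n) (Fin n) ℂ} {t : ℝ}
    (h : ∀ i j, DifferentiableAt ℝ (fun s => A s i j) t) (hd : (A t).det ≠ 0) (i j : Fin n) :
    DifferentiableAt ℝ (fun s => (A s)⁻¹ i j) t := by
  have hdet : ∀ B : ℝ → Matrix (Fin n) (Fin n) ℂ,
      (∀ i j, DifferentiableAt ℝ (fun s => B s i j) t) →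
      DifferentiableAt ℝ (fun s => (B s).det) t := by
    intro B hB
    exact (jacobi_det (A' := fun t => Matrix.of fun i j => deriv (fun s => B s i j) t)
      (fun i j => (hB i j).hasDerivAt)).differentiableAt
  have e : (fun s => (A s)⁻¹ i j) = fun s => ((A s).det)⁻¹ *
      ((A s).updateRow j (Pi.single i 1)).det := by
    ext s
    rw [Matrix.inv_def, Matrix.smul_apply, Ring.inverse_eq_inv', Matrix.adjugate_apply, smul_eq_mul]
  rw [e]
  refine ((hdet _ h).inv hd).mul (hdet _ ?_)
  intro a b
  by_cases ha : a = j
  · subst ha; simp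
  · simpa [Matrix.updateRow_ne ha] using h a b

/-- log-det derivative computations along a curve -/
lemma curve_lemma {n : ℕ} (lam : Fin n → ℝ) (c : ℝ) (H H1 : ℝ → Matrix (Fin n) (Fin n) ℝ)
    (H2 : Matrix (Fin n) (Fin n) ℝ) (v v1 : ℝ → ℝ) (v2 : ℝ)
    (hH0 : H 0 = Matrix.diagonal lam)
    (hsymm : ∀ i j, H1 0 i j = H1 0 j i)
    (hH : ∀ᶠ t in nhds (0:ℝ), ∀ i j, HasDerivAt (fun s => H s i j) (H1 t i j) t)
    (hH1 : ∀ i j, HasDerivAt (fun s => H1 s i j) (H2 i j) 0)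
    (hv : ∀ᶠ t in nhds (0:ℝ), HasDerivAt v (v1 t) t)
    (hv1 : HasDerivAt v1 v2 0)
    (hdet : ∀ᶠ t in nhds (0:ℝ), (1 + Complex.I • (H t).map Complex.ofReal).det
      = Complex.exp (v t + c * Complex.I)) :
    (v1 0 = ∑ j, lam j * (1 + lam j ^ 2)⁻¹ * H1 0 j j) ∧
    (0 = ∑ j, (1 + lam j ^ 2)⁻¹ * H1 0 j j) ∧
    (v2 = ∑ j, lam j * (1 + lam j ^ 2)⁻¹ * H2 j j +
      ∑ j, ∑ m, (1 + lam j ^ 2)⁻¹ * (1 + lam m ^ 2)⁻¹ * (1 - lam j * lam m) * H1 0 j m ^ 2) ∧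
    (∑ j, (1 + lam j ^ 2)⁻¹ * H2 j j =
      ∑ j, ∑ m, (1 + lam j ^ 2)⁻¹ * (1 + lam m ^ 2)⁻¹ * (lam j + lam m) * H1 0 j m ^ 2) := by
  set A : ℝ → Matrix (Fin n) (Fin n) ℂ := fun t => 1 + Complex.I • (H t).map Complex.ofReal with hA
  set A1 : ℝ → Matrix (Fin n) (Fin n) ℂ := fun t => Complex.I • (H1 t).map Complex.ofReal with hA1
  set A2 : Matrix (Fin n) (Fin n) ℂ := Complex.I • H2.map Complex.ofReal with hA2
  have dA : ∀ᶠ t in nhds (0:ℝ), ∀ i j, HasDerivAt (fun s => A s i j) (A1 t i j) t := by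
    filter_upwards [hH] with t ht i j
    have := ((ht i j).ofReal_comp.const_mul Complex.I).const_add ((1 : Matrix (Fin n) (Fin n) ℂ) i j)
    simpa [hA, hA1] using this
  have dA1 : ∀ i j, HasDerivAt (fun s => A1 s i j) (A2 i j) 0 := by
    intro i j
    have := ((hH1 i j).ofReal_comp.const_mul Complex.I)
    simpa [hA2, hA1] using this
  have hdne : ∀ᶠ t in nhds (0:ℝ), (A t).det ≠ 0 := by
    filter_upwards [hdet] with t ht
    rw [ht]; exact Complex.exp_ne_zero _
  have key : ∀ᶠ t in nhds (0:ℝ), (v1 t : ℂ) = ((A t)⁻¹ * A1 t).trace := by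
    filter_upwards [hdet.eventually_nhds, dA, hv, hdne] with t ht hdA hvt hne
    have e1 := jacobi_det (A := A) (A' := A1) (t := t) hdA
    have e2 : HasDerivAt (fun s => Complex.exp (v s + c * Complex.I))
        (Complex.exp (v t + c * Complex.I) * (v1 t : ℂ)) t :=
      ((hvt.ofReal_comp).add_const _).cexp
    have e3 := (e1.congr_of_eventuallyEq (Filter.EventuallyEq.symm ht)).unique e2
    rw [← ht.self_of_nhds] at e3
    change _ = (A t).det * _ at e3
    rw [Matrix.inv_def, Ring.inverse_eq_inv', Matrix.smul_mul, Matrix.trace_smul, e3, smul_eq_mul]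
    field_simp
  have dW := fun i j => (diff_inv_entry (A := A) (t := 0)
    (fun i j => (dA.self_of_nhds i j).differentiableAt) hdne.self_of_nhds i j).hasDerivAt
  set W1 : Matrix (Fin n) (Fin n) ℂ := Matrix.of fun i j => deriv (fun s => (A s)⁻¹ i j) 0 with hW1
  have dW' : ∀ i j, HasDerivAt (fun s => (A s)⁻¹ i j) (W1 i j) 0 := dW
  have hW : A1 0 * (A 0)⁻¹ + A 0 * W1 = 0 := by
    ext i j
    have e1 : HasDerivAt (fun s => (A s * (A s)⁻¹) i j)
        (∑ k, (A1 0 i k * (A 0)⁻¹ k j + A 0 i k * W1 k j)) 0 := by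
      simp_rw [Matrix.mul_apply]
      exact HasDerivAt.fun_sum fun k _ => (dA.self_of_nhds i k).mul (dW' k j)
    have e2 : HasDerivAt (fun s => (A s * (A s)⁻¹) i j) 0 0 := by
      refine (hasDerivAt_const (0:ℝ) ((1 : Matrix (Fin n) (Fin n) ℂ) i j)).congr_of_eventuallyEq ?_
      filter_upwards [hdne] with t ht
      rw [Matrix.mul_nonsing_inv _ (isUnit_iff_ne_zero.2 ht)]
    have := e1.unique e2
    simpa [Matrix.mul_apply, Finset.sum_add_distrib] using this
  have hW1' : W1 = -((A 0)⁻¹ * A1 0 * (A 0)⁻¹) := by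
    have hu := isUnit_iff_ne_zero.2 hdne.self_of_nhds
    have : (A 0)⁻¹ * (A1 0 * (A 0)⁻¹ + A 0 * W1) = 0 := by rw [hW, mul_zero]
    rw [mul_add, Matrix.nonsing_inv_mul_cancel_left _ _ hu, ← mul_assoc] at this
    exact eq_neg_of_add_eq_zero_right this
  have key2 : (v2 : ℂ) = (W1 * A1 0).trace + ((A 0)⁻¹ * A2).trace := by
    have e1 : HasDerivAt (fun s => ((A s)⁻¹ * A1 s).trace)
        (∑ i, ∑ k, (W1 i k * A1 0 k i + (A 0)⁻¹ i k * A2 k i)) 0 := by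
      simp only [Matrix.trace, Matrix.diag, Matrix.mul_apply]
      exact HasDerivAt.fun_sum fun i _ => HasDerivAt.fun_sum fun k _ => (dW' i k).mul (dA1 k i)
    have e2 := e1.congr_of_eventuallyEq key
    have := hv1.ofReal_comp.unique e2
    rw [this]
    simp [Matrix.trace, Matrix.mul_apply, Finset.sum_add_distrib]
  set w : Fin n → ℂ := fun j => (((1 + lam j ^ 2)⁻¹ : ℝ) : ℂ) * (1 - lam j * Complex.I) with hw
  have hA0 : (A 0)⁻¹ = Matrix.diagonal w := by
    apply Matrix.inv_eq_right_inv
    have : A 0 = Matrix.diagonal (fun j => 1 + Complex.I * lam j) := by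
      simp only [hA, hH0]
      ext i j
      by_cases hij : i = j
      · subst hij; simp
      · simp [hij]
    rw [this, Matrix.diagonal_mul_diagonal, ← Matrix.diagonal_one]
    congr 1
    ext j
    have hp : (1 + (lam j:ℂ) ^ 2) ≠ 0 := by
      have : (0:ℝ) < 1 + lam j ^ 2 := by positivity
      exact_mod_cast this.ne'
    simp only [hw]
    push_cast
    field_simp
    linear_combination (-(lam j:ℂ)^2) * Complex.I_sq
  have k1 := key.self_of_nhds
  rw [hA0] at k1
  rw [hW1', hA0] at key2
  have k1' : (v1 0 : ℂ) = ∑ j, w j * (Complex.I * (H1 0 j j)) := by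
    rw [k1]; simp [Matrix.trace, hA1]
    exact Finset.sum_congr rfl fun j _ => by ring
  have k2' : (v2 : ℂ) = ∑ j, w j * (Complex.I * (H2 j j)) +
     ∑ j, ∑ m, w j * w m * (H1 0 j m)^2 := by
    rw [key2, add_comm]
    congr 1
    · simp [Matrix.trace, hA2]
      exact Finset.sum_congr rfl fun j _ => by ring
    · simp only [Matrix.trace, Matrix.diag, Matrix.neg_mul, Matrix.neg_apply]
      rw [← Finset.sum_congr rfl fun j _ => rfl]
      refine Finset.sum_congr rfl fun j _ => ?_
      rw [Matrix.mul_apply, ← Finset.sum_neg_distrib]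
      refine Finset.sum_congr rfl fun m _ => ?_
      simp only [Matrix.mul_diagonal, Matrix.diagonal_mul, hA1, Matrix.smul_apply, Matrix.map_apply,
        hsymm m j, smul_eq_mul]
      linear_combination (-w j * w m * (H1 0 j m)^2) * Complex.I_sq
  have re1 := congrArg Complex.re k1'
  have im1 := congrArg Complex.im k1'
  have re2 := congrArg Complex.re k2'
  have im2 := congrArg Complex.im k2'
  have wre : ∀ j, (w j).re = (1 + lam j ^ 2)⁻¹ := by intro j; simp only [hw, Complex.re_ofReal_mul]; simp
  have wim : ∀ j, (w j).im = -lam j * (1 + lam j ^ 2)⁻¹ := by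
    intro j; simp only [hw, Complex.im_ofReal_mul]; simp; ring
  have sqre : ∀ x : ℝ, ((x:ℂ)^2).re = x^2 := fun x => by rw [← Complex.ofReal_pow, Complex.ofReal_re]
  have sqim : ∀ x : ℝ, ((x:ℂ)^2).im = 0 := fun x => by rw [← Complex.ofReal_pow, Complex.ofReal_im]
  simp only [Complex.ofReal_re, Complex.ofReal_im, Complex.re_sum, Complex.im_sum, Complex.mul_re,
    Complex.mul_im, Complex.add_re, Complex.add_im, Complex.I_re, Complex.I_im, wre, wim, sqre, sqim] at re1 im1 re2 im2
  refine ⟨?_, ?_, ?_, ?_⟩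
  · rw [re1]; refine Finset.sum_congr rfl fun j _ => ?_; ring
  · refine im1.trans ?_; refine Finset.sum_congr rfl fun j _ => ?_; ring
  · rw [re2]; congr 1
    · refine Finset.sum_congr rfl fun j _ => ?_; ring
    · refine Finset.sum_congr rfl fun j _ => Finset.sum_congr rfl fun m _ => ?_; ring
  · refine sub_eq_zero.1 (Eq.trans ?_ im2.symm)
    rw [sub_eq_add_neg]; congr 1
    · refine Finset.sum_congr rfl fun j _ => ?_; ring
    · rw [← Finset.sum_neg_distrib]
      refine Finset.sum_congr rfl fun j _ => ?_
      rw [← Finset.sum_neg_distrib]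
      refine Finset.sum_congr rfl fun m _ => ?_; ring


/-- directional derivative -/
noncomputable def dd {n : ℕ} (v : EuclideanSpace ℝ (Fin n)) (f : EuclideanSpace ℝ (Fin n) → ℝ) :
    EuclideanSpace ℝ (Fin n) → ℝ := fun x => fderiv ℝ f x v

section smp
variable {n : ℕ}
local notation "E" => EuclideanSpace ℝ (Fin n)

lemma dd_smooth {f : E → ℝ} {U : Set E} (hU : IsOpen U) (hf : ContDiffOn ℝ (⊤ : ℕ∞) f U) (v : E) :
    ContDiffOn ℝ (⊤ : ℕ∞) (dd v f) U := by
  have := hf.fderiv_of_isOpen hU (m := (⊤ : ℕ∞)) (by norm_cast)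
  exact this.clm_apply contDiffOn_const

lemma smooth_diffAt {f : E → ℝ} {U : Set E} (hU : IsOpen U) (hf : ContDiffOn ℝ (⊤ : ℕ∞) f U)
    {x : E} (hx : x ∈ U) : DifferentiableAt ℝ f x :=
  (hf.contDiffAt (hU.mem_nhds hx)).differentiableAt (by simp)

lemma dd_congr {f g : E → ℝ} {U : Set E} (hU : IsOpen U) (h : ∀ x ∈ U, f x = g x) (v : E) :
    ∀ x ∈ U, dd v f x = dd v g x := by
  intro x hx
  have : f =ᶠ[nhds x] g := Filter.eventually_of_mem (hU.mem_nhds hx) h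
  simp only [dd, this.fderiv_eq]

lemma dd_comm {f : E → ℝ} {U : Set E} (hU : IsOpen U) (hf : ContDiffOn ℝ (⊤ : ℕ∞) f U)
    (v w : E) : ∀ x ∈ U, dd v (dd w f) x = dd w (dd v f) x := by
  intro x hx
  have h1 : ContDiffAt ℝ (⊤ : ℕ∞) f x := hf.contDiffAt (hU.mem_nhds hx)
  have h2 := (h1.isSymmSndFDerivAt (by simp; norm_cast)).eq v w
  have h3 : DifferentiableAt ℝ (fderiv ℝ f) x :=
    (h1.fderiv_right (m := 1) (by norm_cast)).differentiableAt (by simp)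
  have e : ∀ a b : E, dd a (dd b f) x = fderiv ℝ (fderiv ℝ f) x a b := by
    intro a b
    change fderiv ℝ (fun y => (fderiv ℝ f y) b) x a = _
    rw [fderiv_clm_apply h3 (differentiableAt_const b)]
    simp
  rw [e, e, h2]

lemma dd_line {f : E → ℝ} {x b : E} {t : ℝ} (hf : DifferentiableAt ℝ f (x + t • b)) :
    HasDerivAt (fun s : ℝ => f (x + s • b)) (dd b f (x + t • b)) t := by
  have h1 : HasDerivAt (fun s : ℝ => x + s • b) b t := by
    simpa using ((hasDerivAt_id t).smul_const b).const_add x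
  exact hf.hasFDerivAt.comp_hasDerivAt t h1

lemma line_mem {U : Set E} (hU : IsOpen U) {x : E} (hx : x ∈ U) (b : E) :
    ∀ᶠ t in nhds (0:ℝ), x + t • b ∈ U := by
  have : ContinuousAt (fun t : ℝ => x + t • b) 0 := by fun_prop
  apply this.eventually
  simpa using hU.mem_nhds hx

lemma dd_dd_le {f : E → ℝ} {U : Set E} (hU : IsOpen U) (hf : ContDiffOn ℝ (⊤ : ℕ∞) f U)
    {x : E} (hx : x ∈ U) (hmax : IsLocalMax f x) (b : E) : dd b (dd b f) x ≤ 0 := by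
  by_contra hcon
  push Not at hcon
  set φ : ℝ → ℝ := fun s => f (x + s • b) with hφ
  have h1 : ∀ᶠ t in nhds (0:ℝ), HasDerivAt φ (dd b f (x + t • b)) t := by
    filter_upwards [line_mem hU hx b] with t ht
    exact dd_line (smooth_diffAt hU hf ht)
  have h1' : deriv φ =ᶠ[nhds 0] fun t => dd b f (x + t • b) := by
    filter_upwards [h1] with t ht using ht.deriv
  have hx0 : x + (0:ℝ) • b = x := by simp
  have h2 : HasDerivAt (fun t : ℝ => dd b f (x + t • b)) (dd b (dd b f) x) 0 := by
    have := dd_line (f := dd b f) (x := x) (b := b) (t := 0)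
      (smooth_diffAt hU (dd_smooth hU hf b) (by simpa using hx))
    simpa using this
  have h3 : deriv (deriv φ) 0 = dd b (dd b f) x := by
    rw [h1'.deriv_eq]; exact h2.deriv
  have hm : IsLocalMax φ 0 := by
    have hc : ContinuousAt (fun t : ℝ => x + t • b) 0 := by fun_prop
    have : ∀ᶠ y in nhds (x + (0:ℝ) • b), f y ≤ f x := by rw [hx0]; exact hmax
    have := hc.eventually this
    filter_upwards [this] with t ht
    simpa [hφ] using ht
  have hmin : IsLocalMin φ 0 := isLocalMin_of_deriv_deriv_pos (by rw [h3]; exact hcon)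
    hm.deriv_eq_zero h1.self_of_nhds.continuousAt
  have hconst : φ =ᶠ[nhds 0] fun _ => φ 0 := by
    filter_upwards [hm, hmin] with t h1 h2 using le_antisymm h1 h2
  have : deriv (deriv φ) 0 = 0 := by
    rw [(hconst.deriv).deriv_eq]; simp
  linarith [h3]

lemma barrier_dd (α : ℝ) (y b x : E) :
    dd b (fun x => Real.exp (-α * ‖x - y‖ ^ 2)) x =
      (-2 * α * inner ℝ (x - y) b) * Real.exp (-α * ‖x - y‖ ^ 2) := by
  have h : HasFDerivAt (fun x : E => Real.exp (-α * ‖x - y‖ ^ 2))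
      (Real.exp (-α * ‖x - y‖ ^ 2) • ((-α) • (2 • (innerSL ℝ (x - y)).comp (ContinuousLinearMap.id ℝ E)))) x := by
    have := ((hasFDerivAt_id x).sub_const y).norm_sq
    exact (this.const_mul (-α)).exp
  simp only [dd, h.fderiv]
  simp [inner_sub_left]
  ring

lemma barrier_dd2 (α : ℝ) (y b x : E) :
    dd b (dd b (fun x => Real.exp (-α * ‖x - y‖ ^ 2))) x =
      (4 * α ^ 2 * (inner ℝ (x - y) b) ^ 2 - 2 * α * ‖b‖ ^ 2) * Real.exp (-α * ‖x - y‖ ^ 2) := by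
  have e : dd b (fun x => Real.exp (-α * ‖x - y‖ ^ 2)) = fun x =>
      (-2 * α * inner ℝ (x - y) b) * Real.exp (-α * ‖x - y‖ ^ 2) := by
    ext x; exact barrier_dd α y b x
  rw [e]
  have h : HasFDerivAt (fun x : E => Real.exp (-α * ‖x - y‖ ^ 2))
      (Real.exp (-α * ‖x - y‖ ^ 2) • ((-α) • (2 • (innerSL ℝ (x - y)).comp (ContinuousLinearMap.id ℝ E)))) x := by
    have := ((hasFDerivAt_id x).sub_const y).norm_sq
    exact (this.const_mul (-α)).exp
  have h2 : HasFDerivAt (fun x : E => -2 * α * inner ℝ (x - y) b)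
      ((-2 * α) • (innerSL ℝ b)) x := by
    have h0 : HasFDerivAt (fun x : E => inner ℝ b (x - y)) (innerSL ℝ b) x :=
      (innerSL ℝ b).hasFDerivAt.comp x ((hasFDerivAt_id x).sub_const y)
    simpa [real_inner_comm] using h0.const_mul (-2 * α)
  have h3 : HasFDerivAt (fun x : E => (-2 * α * inner ℝ (x - y) b) * Real.exp (-α * ‖x - y‖ ^ 2))
      _ x := h2.mul h
  unfold dd
  rw [h3.fderiv]
  simp [inner_sub_left]
  ring

lemma dd_add_mul {f h : E → ℝ} {x : E} (hf : DifferentiableAt ℝ f x)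
    (hh : DifferentiableAt ℝ h x) (ε : ℝ) (b : E) :
    dd b (fun z => f z + ε * h z) x = dd b f x + ε * dd b h x := by
  simp only [dd]
  have h3 : HasFDerivAt (fun z => f z + ε * h z) _ x :=
    hf.hasFDerivAt.add (hh.hasFDerivAt.const_mul ε)
  rw [h3.fderiv]
  simp

set_option maxHeartbeats 1600000 in
theorem strong_max (v : E → ℝ) {U : Set E} (hU : IsOpen U) (hUc : IsPreconnected U)
    (hv : ContDiffOn ℝ (⊤ : ℕ∞) v U)
    (hell : ∀ K ⊆ U, IsCompact K → ∃ θ > 0, ∀ x ∈ K, ∃ b : OrthonormalBasis (Fin n) ℝ E,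
      ∃ g : Fin n → ℝ, (∀ k, θ ≤ g k ∧ g k ≤ 1) ∧ 0 ≤ ∑ k, g k * dd (b k) (dd (b k) v) x)
    (M : ℝ) (hM : ∀ x ∈ U, v x ≤ M) (x0 : E) (hx0 : x0 ∈ U) (hvx0 : v x0 = M) :
    ∀ x ∈ U, v x = M := by
  have hcont := hv.continuousOn
  set Z : Set E := {x | x ∈ U ∧ v x = M} with hZ
  suffices hsub : U ⊆ Z from fun x hx => (hsub hx).2
  apply hUc.subset_of_closure_inter_subset (u := Z)
  rotate_left
  · exact ⟨x0, hx0, hx0, hvx0⟩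
  · rintro x ⟨hxc, hxU⟩
    refine ⟨hxU, ?_⟩
    have hca : ContinuousAt v x := hcont.continuousAt (hU.mem_nhds hxU)
    have h1 : ∃ᶠ y in nhds x, v y = M := (mem_closure_iff_frequently.1 hxc).mono fun y hy => hy.2
    by_contra hne
    exact h1 (hca.eventually_ne hne)
  rw [isOpen_iff_mem_nhds]
  rintro z ⟨hzU, hzM⟩
  by_contra hnot
  obtain ⟨R, hR, hRU⟩ := Metric.nhds_basis_closedBall.mem_iff.1 (hU.mem_nhds hzU)
  -- a nearby point with smaller value
  have hy : ∃ y ∈ Metric.ball z (R/2), v y ≠ M := by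
    by_contra hcon
    push Not at hcon
    apply hnot
    filter_upwards [Metric.ball_mem_nhds z (half_pos hR)] with y hy
    exact ⟨hRU (Metric.ball_subset_closedBall (Metric.ball_subset_ball (by linarith) hy)), hcon y hy⟩
  obtain ⟨y, hyz, hyM⟩ := hy
  have hKc : IsCompact (Metric.closedBall z R ∩ v ⁻¹' {M}) := by
    have h1 : IsClosed (Metric.closedBall z R ∩ v ⁻¹' {M}) :=
      (hcont.mono hRU).preimage_isClosed_of_isClosed Metric.isClosed_closedBall isClosed_singleton
    exact (isCompact_closedBall z R).of_isClosed_subset h1 Set.inter_subset_left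
  obtain ⟨z0, ⟨hz0R, hz0M⟩, hz0min⟩ := hKc.exists_isMinOn ⟨z, by simp [hR.le], hzM⟩
    (f := fun x => dist x y) (by fun_prop)
  have hz0M' : v z0 = M := hz0M
  set r := dist z0 y with hr
  have hrpos : 0 < r := by
    rw [hr, dist_pos]; rintro rfl; exact hyM hz0M'
  have hrR : r < R / 2 := by
    have : r ≤ dist z y := hz0min ⟨by simp [hR.le], hzM⟩
    rw [Metric.mem_ball, dist_comm] at hyz
    linarith
  have hballU : Metric.ball y r ⊆ Metric.closedBall z R := by
    intro x hx
    rw [Metric.mem_ball] at hx hyz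
    rw [Metric.mem_closedBall]
    linarith [dist_triangle x y z]
  have hball : ∀ x ∈ Metric.ball y r, v x < M := by
    intro x hx
    refine lt_of_le_of_ne (hM x (hRU (hballU hx))) fun h => ?_
    have : r ≤ dist x y := hz0min ⟨hballU hx, h⟩
    rw [Metric.mem_ball] at hx
    linarith
  -- interior tangent ball
  set e : E := (1/2 : ℝ) • (z0 - y) with he
  set y' : E := y + e with hy'
  set r' : ℝ := r / 2 with hr'
  have hr'pos : 0 < r' := by positivity
  have hnorme : ‖e‖ = r' := by
    rw [he, norm_smul, hr', hr, dist_eq_norm]; norm_num; ring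
  have hz0e : z0 = y' + e := by
    rw [hy', he, add_assoc, ← add_smul]; norm_num
  have htan : ∀ x, ‖x - y'‖ ≤ r' → x ≠ z0 → v x < M := by
    intro x hx hxz
    apply hball
    rw [Metric.mem_ball]
    by_contra hcon
    push Not at hcon
    apply hxz
    set a := x - y' with ha
    have h1 : x - y = a + e := by rw [ha, hy']; abel
    rw [dist_eq_norm, h1] at hcon
    have h2 := parallelogram_law_with_norm ℝ a e
    have h3 : ‖a - e‖ * ‖a - e‖ ≤ 0 := by
      have : r * r ≤ ‖a + e‖ * ‖a + e‖ := mul_self_le_mul_self hrpos.le hcon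
      have : ‖a‖ * ‖a‖ ≤ r' * r' := mul_self_le_mul_self (norm_nonneg _) hx
      rw [hnorme] at h2
      rw [hr'] at *
      nlinarith
    have h4 : ‖a - e‖ = 0 := by nlinarith [norm_nonneg (a - e)]
    have h5 : a = e := by rwa [norm_eq_zero, sub_eq_zero] at h4
    rw [hz0e, ← h5, ha]; abel
  obtain ⟨ρ0, hρ0, hρ0U⟩ := Metric.nhds_basis_closedBall.mem_iff.1 (hU.mem_nhds (hRU hz0R))
  set ρ := min ρ0 (r'/2) with hρ
  have hρpos : 0 < ρ := lt_min hρ0 (by positivity)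
  have hρr : ρ ≤ r'/2 := min_le_right _ _
  have hKU : Metric.closedBall z0 ρ ⊆ U :=
    (Metric.closedBall_subset_closedBall (min_le_left _ _)).trans hρ0U
  obtain ⟨θ, hθ, hθK⟩ := hell _ hKU (isCompact_closedBall z0 ρ)
  have hlow : ∀ x ∈ Metric.closedBall z0 ρ, r'/2 ≤ ‖x - y'‖ := by
    intro x hx
    rw [Metric.mem_closedBall, dist_eq_norm] at hx
    have h1 : e = (x - y') - (x - z0) := by rw [hz0e]; abel
    have h2 := norm_sub_le (x - y') (x - z0)
    rw [← h1, hnorme] at h2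
    linarith
  set α : ℝ := (2 * n + 1) / (θ * r' ^ 2) with hα
  have hαpos : 0 < α := by positivity
  have hαeq : α * (θ * r' ^ 2) = 2 * n + 1 := by rw [hα]; field_simp
  set h : E → ℝ := fun x => Real.exp (-α * ‖x - y'‖ ^ 2) with hh
  have hsm : ContDiff ℝ (⊤ : ℕ∞) h := by
    rw [hh]
    exact ((contDiff_const.mul ((contDiff_id.sub contDiff_const).norm_sq ℝ)).exp)
  set q : ℝ := Real.exp (-α * r' ^ 2) with hq
  have hε : ∃ ε > 0, ∀ x ∈ Metric.sphere z0 ρ ∩ Metric.closedBall y' r', v x + ε * h x < M + ε * q := by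
    set S := Metric.sphere z0 ρ ∩ Metric.closedBall y' r' with hS
    have hSc : IsCompact S := (isCompact_sphere z0 ρ).inter_right Metric.isClosed_closedBall
    have hSU : S ⊆ U := fun x hx => hKU (Metric.sphere_subset_closedBall hx.1)
    rcases S.eq_empty_or_nonempty with h0 | h0
    · exact ⟨1, one_pos, by simp [h0]⟩
    · obtain ⟨s, hs, hsmax⟩ := hSc.exists_isMaxOn h0 (hcont.mono hSU)
      have hsM : v s < M := by
        apply htan
        · have := hs.2; rwa [Metric.mem_closedBall, dist_eq_norm] at this
        · rintro rfl; have := hs.1; simp at this; linarith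
      refine ⟨(M - v s)/2, by linarith, fun x hx => ?_⟩
      have h1 : v x ≤ v s := hsmax hx
      have h2 : h x ≤ 1 := by
        rw [hh]; apply Real.exp_le_one_iff.2
        have : 0 ≤ α * ‖x - y'‖^2 := by positivity
        linarith
      have h3 : 0 < q := Real.exp_pos _
      nlinarith
  obtain ⟨ε, hεpos, hεS⟩ := hε
  set w : E → ℝ := fun x => v x + ε * h x with hw
  have hwU : ContDiffOn ℝ (⊤ : ℕ∞) w U := hv.add (contDiffOn_const.mul hsm.contDiffOn)
  obtain ⟨x1, hx1, hx1max⟩ := (isCompact_closedBall z0 ρ).exists_isMaxOn ⟨z0, by simp [hρpos.le]⟩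
    (hwU.continuousOn.mono hKU)
  have hwz0 : w z0 = M + ε * q := by
    simp only [hw, hh, hq, hz0M']
    rw [show z0 - y' = e by rw [hz0e]; abel, hnorme]
  have hwx1 : M + ε * q ≤ w x1 := by
    rw [← hwz0]; exact hx1max (by simp [hρpos.le])
  have hx1b : x1 ∈ Metric.ball z0 ρ := by
    by_contra hcon
    have hsph : x1 ∈ Metric.sphere z0 ρ := by
      rw [Metric.mem_closedBall] at hx1
      rw [Metric.mem_ball] at hcon
      rw [Metric.mem_sphere]; exact le_antisymm hx1 (not_lt.1 hcon)
    by_cases hc : x1 ∈ Metric.closedBall y' r'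
    · have := hεS x1 ⟨hsph, hc⟩
      simp only [hw] at hwx1
      linarith
    · rw [Metric.mem_closedBall, dist_eq_norm, not_le] at hc
      have h1 : h x1 < q := by
        simp only [hh, hq]
        apply Real.exp_lt_exp.2
        have : r' ^ 2 < ‖x1 - y'‖ ^ 2 := by gcongr
        nlinarith
      have h2 := hM x1 (hKU hx1)
      simp only [hw] at hwx1
      nlinarith
  have hx1U := hKU hx1
  have hloc : IsLocalMax w x1 := by
    filter_upwards [Metric.isOpen_ball.mem_nhds hx1b] with x hx
    exact hx1max (Metric.ball_subset_closedBall hx)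
  obtain ⟨b, g, hg, hgs⟩ := hθK x1 hx1
  have hdw : ∀ k, dd (b k) (dd (b k) w) x1 = dd (b k) (dd (b k) v) x1 +
      ε * dd (b k) (dd (b k) h) x1 := by
    intro k
    have h1 : ∀ x ∈ U, dd (b k) w x = dd (b k) v x + ε * dd (b k) h x := fun x hx =>
      dd_add_mul (smooth_diffAt hU hv hx) (smooth_diffAt hU hsm.contDiffOn hx) ε _
    rw [dd_congr hU h1 (b k) x1 hx1U]
    exact dd_add_mul (smooth_diffAt hU (dd_smooth hU hv _) hx1U)
      (smooth_diffAt hU (dd_smooth hU hsm.contDiffOn _) hx1U) ε _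
  have hneg : ∑ k, g k * dd (b k) (dd (b k) w) x1 ≤ 0 := by
    apply Finset.sum_nonpos
    intro k _
    have := dd_dd_le hU hwU hx1U hloc (b k)
    have := (hg k).1
    nlinarith
  have hsum : ∑ k, (inner ℝ (x1 - y') (b k)) ^ 2 = ‖x1 - y'‖ ^ 2 := by
    rw [← b.sum_sq_norm_inner_right (x1 - y')]
    refine Finset.sum_congr rfl fun k _ => ?_
    rw [Real.norm_eq_abs, sq_abs, real_inner_comm]
  have hpos : 0 < ∑ k, g k * dd (b k) (dd (b k) h) x1 := by
    have h1 : ∀ k, (4 * α ^ 2 * θ * (inner ℝ (x1 - y') (b k)) ^ 2 - 2 * α) * h x1 ≤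
        g k * dd (b k) (dd (b k) h) x1 := by
      intro k
      rw [hh, barrier_dd2, ← mul_assoc]
      refine mul_le_mul_of_nonneg_right ?_ (Real.exp_pos _).le
      rw [b.norm_eq_one k]
      obtain ⟨hg1, hg2⟩ := hg k
      have : 0 ≤ (g k - θ) * (4 * α ^ 2 * (inner ℝ (x1 - y') (b k)) ^ 2) :=
        mul_nonneg (by linarith) (by positivity)
      nlinarith
    refine lt_of_lt_of_le ?_ (Finset.sum_le_sum fun k _ => h1 k)
    rw [← Finset.sum_mul, Finset.sum_sub_distrib, ← Finset.mul_sum, hsum]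
    refine mul_pos ?_ (Real.exp_pos _)
    simp only [Finset.sum_const, Finset.card_univ, Fintype.card_fin, nsmul_eq_mul]
    have h2 : (r'/2)^2 ≤ ‖x1 - y'‖^2 := by
      have := hlow x1 hx1
      gcongr
    have h3 : 4 * α ^ 2 * θ * (r'/2)^2 ≤ 4 * α ^ 2 * θ * ‖x1 - y'‖^2 := by gcongr
    have h4 : 4 * α ^ 2 * θ * (r'/2)^2 = α * (2 * n + 1) := by rw [← hαeq]; ring
    nlinarith
  have : ∑ k, g k * dd (b k) (dd (b k) w) x1 = ∑ k, g k * dd (b k) (dd (b k) v) x1 +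
      ε * ∑ k, g k * dd (b k) (dd (b k) h) x1 := by
    rw [Finset.mul_sum, ← Finset.sum_add_distrib]
    refine Finset.sum_congr rfl fun k _ => ?_
    rw [hdw]; ring
  have : 0 < ε * ∑ k, g k * dd (b k) (dd (b k) h) x1 := mul_pos hεpos hpos
  linarith

end smp


lemma same_sign {p q s : ℝ} (h : 0 ≤ p * q) (hp : s ≤ p ^ 2) (hq : s ≤ q ^ 2) : s ≤ p * q := by
  by_contra hc
  push Not at hc
  have hs : 0 < s := lt_of_le_of_lt h hc
  have h1 : s * s ≤ p ^ 2 * q ^ 2 := mul_le_mul hp hq hs.le (sq_nonneg _)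
  nlinarith

lemma triple_nonneg {a b c : ℝ} (hab : 0 ≤ 3 + a ^ 2 + 2 * a * b) (hba : 0 ≤ 3 + b ^ 2 + 2 * b * a)
    (hac : 0 ≤ 3 + a ^ 2 + 2 * a * c) (hca : 0 ≤ 3 + c ^ 2 + 2 * c * a)
    (hbc : 0 ≤ 3 + b ^ 2 + 2 * b * c) (hcb : 0 ≤ 3 + c ^ 2 + 2 * c * b) :
    0 ≤ 3 + a * b + b * c + c * a := by
  have key : ∀ x y z : ℝ, 0 ≤ (x + y) * (x + z) → 0 ≤ 3 + y ^ 2 + 2 * y * x →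
      0 ≤ 3 + z ^ 2 + 2 * z * x → 0 ≤ 3 + x * y + y * z + z * x := by
    intro x y z h h1 h2
    have := same_sign (s := x ^ 2 - 3) h (by nlinarith) (by nlinarith)
    nlinarith
  have hor : 0 ≤ (a + b) * (a + c) ∨ 0 ≤ (b + a) * (b + c) ∨ 0 ≤ (c + a) * (c + b) := by
    by_contra hcon
    push Not at hcon
    obtain ⟨h1, h2, h3⟩ := hcon
    have : 0 < ((a + b) * (a + c)) * ((b + a) * (b + c)) := mul_pos_of_neg_of_neg h1 h2
    nlinarith [sq_nonneg ((a+b)*(a+c)*(b+c)), sq_nonneg (a+b)]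
  rcases hor with h | h | h
  · exact key a b c h hba hca
  · have := key b a c h hab hcb; linarith
  · have := key c a b h hac hbc; linarith

lemma sum_alg {n : ℕ} (lam g v2 : Fin n → ℝ) (q : Fin n → Fin n → ℝ)
    (T : Fin n → Fin n → Fin n → ℝ)
    (hq : ∀ j m, q j m = q m j)
    (hT1 : ∀ i j k, T i j k = T j i k) (hT2 : ∀ i j k, T i j k = T i k j)
    (hA : ∀ m, v2 m = ∑ j, lam j * g j * q m j +
      ∑ j, ∑ k, g j * g k * (1 - lam j * lam k) * T m j k ^ 2)
    (hB : ∀ m, ∑ j, g j * q m j = ∑ j, ∑ k, g j * g k * (lam j + lam k) * T m j k ^ 2) :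
    ∑ m, g m * v2 m = (1/3) * ∑ m, ∑ j, ∑ k, (g m * g j * g k) *
      (3 + lam m * lam j + lam j * lam k + lam k * lam m) * T m j k ^ 2 := by
  set G : Fin n → Fin n → Fin n → ℝ := fun m j k => g m * g j * g k * T m j k ^ 2 with hG
  have G1 : ∀ i j k, G i j k = G j i k := by intro i j k; simp only [hG, hT1 i j k]; ring
  have G2 : ∀ i j k, G i j k = G i k j := by intro i j k; simp only [hG, hT2 i j k]; ring
  set X := ∑ m, ∑ j, ∑ k, lam m * lam j * G m j k with hX
  set Y := ∑ m, ∑ j, ∑ k, G m j k with hY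
  have X2 : ∑ m, ∑ j, ∑ k, lam k * lam m * G m j k = X := by
    rw [hX]
    refine Finset.sum_congr rfl fun m _ => ?_
    rw [Finset.sum_comm]
    refine Finset.sum_congr rfl fun j _ => Finset.sum_congr rfl fun k _ => ?_
    rw [G2 m k j]; ring
  have X3 : ∑ m, ∑ j, ∑ k, lam j * lam k * G m j k = X := by
    rw [← X2, Finset.sum_comm]
    refine Finset.sum_congr rfl fun m _ => Finset.sum_congr rfl fun j _ =>
      Finset.sum_congr rfl fun k _ => ?_
    rw [G1]; ring
  have e1 : ∑ m, ∑ j, ∑ k, (g m * g j * g k) *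
      (3 + lam m * lam j + lam j * lam k + lam k * lam m) * T m j k ^ 2 = 3 * Y + X + X + X := by
    calc _ = ∑ m, ∑ j, ∑ k, (3 * G m j k + lam m * lam j * G m j k + lam j * lam k * G m j k
          + lam k * lam m * G m j k) := by
          refine Finset.sum_congr rfl fun m _ => Finset.sum_congr rfl fun j _ =>
            Finset.sum_congr rfl fun k _ => ?_
          simp only [hG]; ring
      _ = _ := by
          simp only [Finset.sum_add_distrib, ← Finset.mul_sum]
          simp only [Finset.mul_sum]
          rw [X2, X3, ← hX, hY]
          simp only [Finset.mul_sum]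
  have e2 : ∑ m, g m * ∑ j, lam j * g j * q m j = X + X := by
    calc _ = ∑ j, lam j * g j * ∑ m, g m * q j m := by
          simp only [Finset.mul_sum]
          rw [Finset.sum_comm]
          refine Finset.sum_congr rfl fun m _ => Finset.sum_congr rfl fun j _ => ?_
          rw [hq j m]; ring
      _ = ∑ m, ∑ j, ∑ k, (lam m * lam j * G m j k + lam k * lam m * G m j k) := by
          refine Finset.sum_congr rfl fun m _ => ?_
          rw [hB m]
          simp only [Finset.mul_sum]
          refine Finset.sum_congr rfl fun j _ =>
            Finset.sum_congr rfl fun k _ => ?_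
          simp only [hG]; ring
      _ = _ := by
          simp only [Finset.sum_add_distrib]
          rw [X2]
  have e3 : ∑ m, g m * ∑ j, ∑ k, g j * g k * (1 - lam j * lam k) * T m j k ^ 2 = Y - X := by
    calc _ = ∑ m, ∑ j, ∑ k, (G m j k - lam j * lam k * G m j k) := by
          simp only [Finset.mul_sum]
          refine Finset.sum_congr rfl fun m _ => Finset.sum_congr rfl fun j _ =>
            Finset.sum_congr rfl fun k _ => ?_
          simp only [hG]; ring
      _ = _ := by
          simp only [Finset.sum_sub_distrib]
          rw [X3]
  rw [e1]
  simp only [hA, mul_add, Finset.sum_add_distrib]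
  rw [e2, e3]; ring

/-- the equality case -/
lemma eq_case {n : ℕ} (lam : Fin n → ℝ) (m : Fin n) (t : Fin n → ℝ)
    (hc : ∀ i j, 0 ≤ 3 + lam i ^ 2 + 2 * lam i * lam j)
    (ht : ∀ j, (3 + lam j ^ 2 + 2 * lam j * lam m) * t j ^ 2 = 0)
    (hs : 0 = ∑ j, (1 + lam j ^ 2)⁻¹ * t j) :
    ∑ j, t j = 0 ∧ ∑ j, lam j * t j = 0 := by
  by_cases h0 : ∀ j, t j = 0
  · simp [h0]
  push Not at h0
  obtain ⟨j0, hj0⟩ := h0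
  have hroot : ∀ j, t j ≠ 0 → 3 + lam j ^ 2 + 2 * lam j * lam m = 0 := by
    intro j hj
    rcases mul_eq_zero.1 (ht j) with h | h
    · exact h
    · exact absurd (pow_eq_zero_iff (two_ne_zero) |>.1 h) hj
  have heq : ∀ j, t j ≠ 0 → lam j = lam j0 := by
    intro j hj
    have h1 := hroot j hj
    have h2 := hroot j0 hj0
    have h3 := hc m j
    have h4 := hc m j0
    have h5 : (lam j - lam j0) * (lam j + lam j0 + 2 * lam m) = 0 := by nlinarith
    rcases mul_eq_zero.1 h5 with h | h
    · linarith
    · have hm : lam m = -(lam j + lam j0)/2 := by linarith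
      rw [hm] at h1 h2 h3 h4
      nlinarith [sq_nonneg (lam j - lam j0)]
  have hval : ∀ f : ℝ → ℝ, ∑ j, f (lam j) * t j = f (lam j0) * ∑ j, t j := by
    intro f
    rw [Finset.mul_sum]
    refine Finset.sum_congr rfl fun j _ => ?_
    by_cases hj : t j = 0
    · simp [hj]
    · rw [heq j hj]
  have hs0 : ∑ j, t j = 0 := by
    have := hval (fun x => (1 + x ^ 2)⁻¹)
    rw [← hs] at this
    have hp : (1 + lam j0 ^ 2)⁻¹ ≠ 0 := by positivity
    exact (mul_eq_zero.1 this.symm).resolve_left hp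
  refine ⟨hs0, ?_⟩
  have := hval id
  simpa [hs0] using this


section basis
variable {n : ℕ}
local notation "E" => EuclideanSpace ℝ (Fin n)

lemma dd_dd_eq {f : E → ℝ} {U : Set E} (hU : IsOpen U) (hf : ContDiffOn ℝ (⊤ : ℕ∞) f U)
    {x : E} (hx : x ∈ U) (a b : E) : dd a (dd b f) x = fderiv ℝ (fderiv ℝ f) x a b := by
  have h1 : ContDiffAt ℝ (⊤ : ℕ∞) f x := hf.contDiffAt (hU.mem_nhds hx)
  have h3 : DifferentiableAt ℝ (fderiv ℝ f) x :=
    (h1.fderiv_right (m := 1) (by norm_cast)).differentiableAt (by simp)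
  change fderiv ℝ (fun y => (fderiv ℝ f y) b) x a = _
  rw [fderiv_clm_apply h3 (differentiableAt_const b)]
  simp

lemma Hess_eq_dd {f : E → ℝ} {U : Set E} (hU : IsOpen U) (hf : ContDiffOn ℝ (⊤ : ℕ∞) f U)
    {x : E} (hx : x ∈ U) (i j : Fin n) :
    Hess f x i j = dd (EuclideanSpace.single i 1) (dd (EuclideanSpace.single j 1) f) x := by
  rw [dd_dd_eq hU hf hx]
  simp [Hess, iteratedFDeriv_two_apply]

lemma vec_eq_sum (a : E) : a = ∑ i, a i • EuclideanSpace.single i (1:ℝ) := by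
  have := (EuclideanSpace.basisFun (Fin n) ℝ).sum_repr a
  simpa using this.symm

lemma dd_dd_Hess {f : E → ℝ} {U : Set E} (hU : IsOpen U) (hf : ContDiffOn ℝ (⊤ : ℕ∞) f U)
    {x : E} (hx : x ∈ U) (a b : E) :
    dd a (dd b f) x = ∑ i, ∑ j, Hess f x i j * a i * b j := by
  simp_rw [Hess_eq_dd hU hf hx, dd_dd_eq hU hf hx]
  conv_lhs => rw [vec_eq_sum a, vec_eq_sum b]
  simp only [map_sum, map_smul, sum_apply, smul_apply,
    smul_eq_mul, Finset.mul_sum]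
  rw [Finset.sum_comm]
  refine Finset.sum_congr rfl fun i _ => Finset.sum_congr rfl fun j _ => ?_
  ring

/-- Hessian in a basis -/
noncomputable def Mb (b : OrthonormalBasis (Fin n) ℝ (EuclideanSpace ℝ (Fin n)))
    (f : EuclideanSpace ℝ (Fin n) → ℝ)
    (x : EuclideanSpace ℝ (Fin n)) : Matrix (Fin n) (Fin n) ℝ :=
  Matrix.of fun j k => dd (b j) (dd (b k) f) x

noncomputable def Bm (b : OrthonormalBasis (Fin n) ℝ (EuclideanSpace ℝ (Fin n))) :
    Matrix (Fin n) (Fin n) ℝ := Matrix.of fun i k => b k i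

lemma Bm_orth (b : OrthonormalBasis (Fin n) ℝ E) : (Bm b).transpose * Bm b = 1 := by
  ext j k
  have h := orthonormal_iff_ite.1 b.orthonormal k j
  rw [Matrix.mul_apply, Matrix.one_apply]
  rw [PiLp.inner_apply] at h
  simp only [Bm, Matrix.transpose_apply, Matrix.of_apply]
  simp at h
  rw [h]
  simp [eq_comm]

lemma Bm_orth2 (b : OrthonormalBasis (Fin n) ℝ E) : Bm b * (Bm b).transpose = 1 :=
  mul_eq_one_comm.1 (Bm_orth b)

lemma Mb_eq {f : E → ℝ} {U : Set E} (hU : IsOpen U) (hf : ContDiffOn ℝ (⊤ : ℕ∞) f U)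
    {x : E} (hx : x ∈ U) (b : OrthonormalBasis (Fin n) ℝ E) :
    Mb b f x = (Bm b).transpose * Hess f x * Bm b := by
  ext j k
  simp only [Mb, Matrix.of_apply, dd_dd_Hess hU hf hx, Matrix.mul_apply, Bm, Matrix.transpose_apply,
    Finset.sum_mul]
  rw [Finset.sum_comm]
  refine Finset.sum_congr rfl fun i _ => Finset.sum_congr rfl fun l _ => ?_
  ring

lemma det_Mb {f : E → ℝ} {U : Set E} (hU : IsOpen U) (hf : ContDiffOn ℝ (⊤ : ℕ∞) f U)
    {x : E} (hx : x ∈ U) (b : OrthonormalBasis (Fin n) ℝ E) :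
    (1 + Complex.I • (Mb b f x).map Complex.ofReal).det =
      (1 + Complex.I • (Hess f x).map Complex.ofReal).det := by
  rw [Mb_eq hU hf hx b]
  set B := (Bm b).map Complex.ofReal with hB
  set Bt := (Bm b).transpose.map Complex.ofReal with hBt
  have h1 : Bt * B = 1 := by
    have h0 : ((Bm b).transpose * Bm b).map Complex.ofReal = Bt * B :=
      Matrix.map_mul (f := Complex.ofRealHom)
    rw [← h0, Bm_orth]
    ext i j
    by_cases hij : i = j
    · subst hij; simp
    · simp [hij]
  have h2 : ((Bm b).transpose * Hess f x * Bm b).map Complex.ofReal =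
      Bt * (Hess f x).map Complex.ofReal * B := by
    have : ∀ M N : Matrix (Fin n) (Fin n) ℝ, (M * N).map Complex.ofReal =
        M.map Complex.ofReal * N.map Complex.ofReal := fun M N =>
      Matrix.map_mul (f := Complex.ofRealHom)
    rw [this, this]
  have h3 : (1 + Complex.I • (Bt * (Hess f x).map Complex.ofReal * B)) =
      Bt * (1 + Complex.I • (Hess f x).map Complex.ofReal) * B := by
    rw [mul_add, add_mul, mul_one, h1]
    simp
  rw [h2, h3, Matrix.det_mul, Matrix.det_mul, mul_comm, ← mul_assoc]
  have := congrArg Matrix.det h1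
  rw [Matrix.det_mul, Matrix.det_one] at this
  rw [mul_comm B.det, this, one_mul]

lemma trace_Mb {f : E → ℝ} {U : Set E} (hU : IsOpen U) (hf : ContDiffOn ℝ (⊤ : ℕ∞) f U)
    {x : E} (hx : x ∈ U) (b : OrthonormalBasis (Fin n) ℝ E) :
    (Mb b f x).trace = (Hess f x).trace := by
  rw [Mb_eq hU hf hx b, Matrix.trace_mul_comm, ← mul_assoc, Bm_orth2, one_mul]

lemma trace2_Mb {f : E → ℝ} {U : Set E} (hU : IsOpen U) (hf : ContDiffOn ℝ (⊤ : ℕ∞) f U)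
    {x : E} (hx : x ∈ U) (b : OrthonormalBasis (Fin n) ℝ E) :
    (Mb b f x * Mb b f x).trace = (Hess f x * Hess f x).trace := by
  have e : Mb b f x * Mb b f x = (Bm b).transpose * (Hess f x * Hess f x) * Bm b := by
    rw [Mb_eq hU hf hx b]
    calc _ = (Bm b).transpose * Hess f x * (Bm b * (Bm b).transpose) * Hess f x * Bm b := by
          simp only [mul_assoc]
      _ = _ := by rw [Bm_orth2]; simp only [mul_assoc, mul_one]
  rw [e, Matrix.trace_mul_comm, ← mul_assoc, Bm_orth2, one_mul]

lemma Mb_diag {f : E → ℝ} {U : Set E} (hU : IsOpen U) (hf : ContDiffOn ℝ (⊤ : ℕ∞) f U)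
    {x : E} (hx : x ∈ U) (hs : (Hess f x).IsHermitian) :
    Mb hs.eigenvectorBasis f x = Matrix.diagonal hs.eigenvalues := by
  rw [Mb_eq hU hf hx, mul_assoc]
  have h : Hess f x * Bm hs.eigenvectorBasis =
      Bm hs.eigenvectorBasis * Matrix.diagonal hs.eigenvalues := by
    ext i k
    have := congrFun (hs.mulVec_eigenvectorBasis k) i
    rw [Matrix.mul_diagonal]
    simp only [Matrix.mulVec, dotProduct, Pi.smul_apply, smul_eq_mul] at this
    simp only [Matrix.mul_apply, Bm, Matrix.of_apply]
    rw [this, mul_comm]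
  rw [h, ← mul_assoc, Bm_orth, one_mul]

lemma one_add_I_mul (l : ℝ) : (1 + Complex.I * l : ℂ) =
    (Real.sqrt (1 + l ^ 2) : ℝ) * Complex.exp (Real.arctan l * Complex.I) := by
  have hp : 0 < Real.sqrt (1 + l ^ 2) := Real.sqrt_pos.2 (by positivity)
  rw [Complex.exp_mul_I, ← Complex.ofReal_cos, ← Complex.ofReal_sin, Real.cos_arctan,
    Real.sin_arctan]
  have : ((Real.sqrt (1 + l ^ 2) : ℝ) : ℂ) ≠ 0 := by exact_mod_cast hp.ne'
  push_cast
  field_simp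

lemma det_eq_exp {f : E → ℝ} {U : Set E} (hU : IsOpen U) (hf : ContDiffOn ℝ (⊤ : ℕ∞) f U)
    {x : E} (hx : x ∈ U) (hs : (Hess f x).IsHermitian) {c : ℝ}
    (hc : ∑ i, Real.arctan (hs.eigenvalues i) = c) :
    (1 + Complex.I • (Hess f x).map Complex.ofReal).det =
      ((∏ i, Real.sqrt (1 + hs.eigenvalues i ^ 2) : ℝ) : ℂ) * Complex.exp (c * Complex.I) := by
  rw [← det_Mb hU hf hx hs.eigenvectorBasis, Mb_diag hU hf hx hs]
  have : (1 + Complex.I • (Matrix.diagonal hs.eigenvalues).map Complex.ofReal) =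
      Matrix.diagonal (fun j => 1 + Complex.I * hs.eigenvalues j) := by
    ext i j
    by_cases hij : i = j
    · subst hij; simp
    · simp [hij]
  rw [this, Matrix.det_diagonal]
  simp_rw [one_add_I_mul]
  rw [Finset.prod_mul_distrib, ← Complex.exp_sum, ← Finset.sum_mul, ← hc]
  push_cast
  rfl

lemma dd_hom {f : E → ℝ} {s : ℝ} (hs : 0 < s) (k : ℕ)
    (hf : ContDiffOn ℝ (⊤ : ℕ∞) f {(0:E)}ᶜ)
    (h : ∀ x : E, x ≠ 0 → f (s • x) = s ^ (k + 1) * f x) (v : E) :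
    ∀ x : E, x ≠ 0 → dd v f (s • x) = s ^ k * dd v f x := by
  intro x hx
  have hU : IsOpen ({(0:E)}ᶜ : Set E) := isOpen_compl_singleton
  have hsx : s • x ≠ 0 := smul_ne_zero hs.ne' hx
  have h1 : HasFDerivAt (fun y : E => f (s • y)) ((fderiv ℝ f (s • x)).comp
      (s • ContinuousLinearMap.id ℝ E)) x :=
    (smooth_diffAt hU hf hsx).hasFDerivAt.comp x ((hasFDerivAt_id x).const_smul s)
  have h2 : HasFDerivAt (fun y : E => s ^ (k + 1) * f y) (s ^ (k + 1) • fderiv ℝ f x) x :=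
    (smooth_diffAt hU hf hx).hasFDerivAt.const_mul _
  have h3 : (fun y : E => f (s • y)) =ᶠ[nhds x] fun y : E => s ^ (k + 1) * f y :=
    Filter.eventually_of_mem (hU.mem_nhds hx) h
  have h4 := congrArg (fun L : E →L[ℝ] ℝ => L v) (h1.unique (h2.congr_of_eventuallyEq h3))
  simp at h4
  simp only [dd]
  have : s * (fderiv ℝ f (s • x) v) = s * (s ^ k * fderiv ℝ f x v) := by
    rw [h4]; ring
  exact mul_left_cancel₀ hs.ne' this

end basis


section main
variable {n : ℕ}
local notation "E" => EuclideanSpace ℝ (Fin n)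

lemma pointwise {u v : E → ℝ} {U : Set E} (hU : IsOpen U) (hu : ContDiffOn ℝ (⊤ : ℕ∞) u U)
    (hv : ContDiffOn ℝ (⊤ : ℕ∞) v U) (c : ℝ)
    (hdet : ∀ x ∈ U, (1 + Complex.I • (Hess u x).map Complex.ofReal).det =
      Complex.exp (v x + c * Complex.I))
    {x : E} (hx : x ∈ U) (b : OrthonormalBasis (Fin n) ℝ E) (lam : Fin n → ℝ)
    (hdiag : Mb b u x = Matrix.diagonal lam) :
    (∀ m, 0 = ∑ j, (1 + lam j ^ 2)⁻¹ * dd (b m) (dd (b j) (dd (b j) u)) x) ∧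
    ∑ m, (1 + lam m ^ 2)⁻¹ * dd (b m) (dd (b m) v) x =
      (1/3) * ∑ m, ∑ j, ∑ k, ((1 + lam m ^ 2)⁻¹ * (1 + lam j ^ 2)⁻¹ * (1 + lam k ^ 2)⁻¹) *
      (3 + lam m * lam j + lam j * lam k + lam k * lam m) *
        dd (b m) (dd (b j) (dd (b k) u)) x ^ 2 := by
  have s1 : ∀ a, ContDiffOn ℝ (⊤ : ℕ∞) (dd a u) U := fun a => dd_smooth hU hu a
  have s2 : ∀ a a', ContDiffOn ℝ (⊤ : ℕ∞) (dd a (dd a' u)) U := fun a a' => dd_smooth hU (s1 a') a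
  have s3 : ∀ a a' a'', ContDiffOn ℝ (⊤ : ℕ∞) (dd a (dd a' (dd a'' u))) U :=
    fun a a' a'' => dd_smooth hU (s2 a' a'') a
  have T2 : ∀ y ∈ U, ∀ i j k, dd (b i) (dd (b j) (dd (b k) u)) y =
      dd (b i) (dd (b k) (dd (b j) u)) y := fun y hy i j k =>
    dd_congr hU (dd_comm hU hu _ _) _ y hy
  have T1 : ∀ y ∈ U, ∀ i j k, dd (b i) (dd (b j) (dd (b k) u)) y =
      dd (b j) (dd (b i) (dd (b k) u)) y := fun y hy i j k => dd_comm hU (s1 _) _ _ y hy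
  have hx0 : ∀ a : E, x + (0:ℝ) • a = x := by simp
  have cl := fun m => curve_lemma lam c (fun t => Mb b u (x + t • b m))
    (fun t => Matrix.of fun j k => dd (b m) (dd (b j) (dd (b k) u)) (x + t • b m))
    (Matrix.of fun j k => dd (b m) (dd (b m) (dd (b j) (dd (b k) u))) x)
    (fun t => v (x + t • b m)) (fun t => dd (b m) v (x + t • b m)) (dd (b m) (dd (b m) v) x)
    (by rw [hx0]; exact hdiag)
    (by
      intro i j
      simp only [Matrix.of_apply, hx0]
      exact T2 x hx m i j)
    (by
      filter_upwards [line_mem hU hx (b m)] with t ht i j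
      exact dd_line (smooth_diffAt hU (s2 _ _) ht))
    (by
      intro i j
      have := dd_line (f := dd (b m) (dd (b i) (dd (b j) u))) (x := x) (b := b m) (t := 0)
        (smooth_diffAt hU (s3 _ _ _) (by simpa using hx))
      rw [hx0] at this
      exact this)
    (by
      filter_upwards [line_mem hU hx (b m)] with t ht
      exact dd_line (smooth_diffAt hU hv ht))
    (by
      have := dd_line (f := dd (b m) v) (x := x) (b := b m) (t := 0)
        (smooth_diffAt hU (dd_smooth hU hv _) (by simpa using hx))
      rw [hx0] at this
      exact this)
    (by
      filter_upwards [line_mem hU hx (b m)] with t ht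
      rw [det_Mb hU hu ht, hdet _ ht])
  simp only [Matrix.of_apply, hx0] at cl
  refine ⟨fun m => (cl m).2.1, ?_⟩
  refine sum_alg lam (fun m => (1 + lam m ^ 2)⁻¹) (fun m => dd (b m) (dd (b m) v) x)
    (fun m j => dd (b m) (dd (b m) (dd (b j) (dd (b j) u))) x)
    (fun m j k => dd (b m) (dd (b j) (dd (b k) u)) x) ?_ (T1 x hx) (T2 x hx)
    (fun m => (cl m).2.2.1) (fun m => (cl m).2.2.2)
  intro j m
  have e1 : dd (b j) (dd (b j) (dd (b m) (dd (b m) u))) x =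
      dd (b j) (dd (b m) (dd (b j) (dd (b m) u))) x :=
    dd_congr hU (fun y hy => T1 y hy _ _ _) _ x hx
  have e2 : dd (b j) (dd (b m) (dd (b j) (dd (b m) u))) x =
      dd (b m) (dd (b j) (dd (b j) (dd (b m) u))) x := dd_comm hU (s2 _ _) _ _ x hx
  have e3 : dd (b m) (dd (b j) (dd (b j) (dd (b m) u))) x =
      dd (b m) (dd (b j) (dd (b m) (dd (b j) u))) x :=
    dd_congr hU (fun y hy => T2 y hy _ _ _) _ x hx
  have e4 : dd (b m) (dd (b j) (dd (b m) (dd (b j) u))) x =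
      dd (b m) (dd (b m) (dd (b j) (dd (b j) u))) x :=
    dd_congr hU (fun y hy => T1 y hy _ _ _) _ x hx
  rw [e1, e2, e3, e4]

/-- the logarithm of the volume -/
noncomputable def vv (u : EuclideanSpace ℝ (Fin n) → ℝ) (c : ℝ) (x : EuclideanSpace ℝ (Fin n)) : ℝ :=
  Real.log (Complex.exp (-(c * Complex.I)) *
    (1 + Complex.I • (Hess u x).map Complex.ofReal).det).re

lemma vv_eq {u : E → ℝ} {U : Set E} (hU : IsOpen U) (hu : ContDiffOn ℝ (⊤ : ℕ∞) u U) (c : ℝ)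
    {x : E} (hx : x ∈ U) (hs : (Hess u x).IsHermitian)
    (hc : ∑ i, Real.arctan (hs.eigenvalues i) = c) :
    (Complex.exp (-(c * Complex.I)) *
      (1 + Complex.I • (Hess u x).map Complex.ofReal).det).re =
      ∏ i, Real.sqrt (1 + hs.eigenvalues i ^ 2) := by
  rw [det_eq_exp hU hu hx hs hc, mul_comm, mul_assoc, ← Complex.exp_add, add_neg_cancel,
    Complex.exp_zero, mul_one, Complex.ofReal_re]

lemma prod_pos' (l : Fin n → ℝ) : 0 < ∏ i, Real.sqrt (1 + l i ^ 2) :=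
  Finset.prod_pos fun i _ => Real.sqrt_pos.2 (by positivity)

lemma vv_det {u : E → ℝ} {U : Set E} (hU : IsOpen U) (hu : ContDiffOn ℝ (⊤ : ℕ∞) u U) (c : ℝ)
    {x : E} (hx : x ∈ U) (hs : (Hess u x).IsHermitian)
    (hc : ∑ i, Real.arctan (hs.eigenvalues i) = c) :
    (1 + Complex.I • (Hess u x).map Complex.ofReal).det =
      Complex.exp (vv u c x + c * Complex.I) := by
  rw [vv, vv_eq hU hu c hx hs hc, det_eq_exp hU hu hx hs hc, Complex.exp_add, ← Complex.ofReal_exp,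
    Real.exp_log (prod_pos' _)]

lemma vv_eig {u : E → ℝ} {U : Set E} (hU : IsOpen U) (hu : ContDiffOn ℝ (⊤ : ℕ∞) u U) (c : ℝ)
    {x : E} (hx : x ∈ U) (hs : (Hess u x).IsHermitian)
    (hc : ∑ i, Real.arctan (hs.eigenvalues i) = c) (k : Fin n) :
    1 + hs.eigenvalues k ^ 2 ≤ Real.exp (2 * vv u c x) := by
  have h1 : ∀ i, 1 ≤ Real.sqrt (1 + hs.eigenvalues i ^ 2) := fun i =>
    Real.one_le_sqrt.2 (by nlinarith [sq_nonneg (hs.eigenvalues i)])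
  have h2 : Real.sqrt (1 + hs.eigenvalues k ^ 2) ≤ ∏ i, Real.sqrt (1 + hs.eigenvalues i ^ 2) := by
    rw [← Finset.mul_prod_erase _ _ (Finset.mem_univ k)]
    exact le_mul_of_one_le_right (Real.sqrt_nonneg _) (Finset.prod_induction _ (fun z => 1 ≤ z)
      (fun _ _ => one_le_mul_of_one_le_of_one_le) le_rfl fun i _ => h1 i)
  rw [vv, vv_eq hU hu c hx hs hc, two_mul, Real.exp_add, Real.exp_log (prod_pos' _)]
  calc _ = Real.sqrt (1 + hs.eigenvalues k ^ 2) * Real.sqrt (1 + hs.eigenvalues k ^ 2) :=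
        (Real.mul_self_sqrt (by positivity)).symm
    _ ≤ _ := mul_le_mul h2 h2 (Real.sqrt_nonneg _) (prod_pos' _).le

lemma Hess_smooth {u : E → ℝ} {U : Set E} (hU : IsOpen U) (hu : ContDiffOn ℝ (⊤ : ℕ∞) u U)
    (i j : Fin n) : ContDiffOn ℝ (⊤ : ℕ∞) (fun x => Hess u x i j) U :=
  (dd_smooth hU (dd_smooth hU hu _) _).congr fun x hx => Hess_eq_dd hU hu hx i j

lemma vv_smooth {u : E → ℝ} {U : Set E} (hU : IsOpen U) (hu : ContDiffOn ℝ (⊤ : ℕ∞) u U) (c : ℝ)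
    (hs : ∀ x ∈ U, ∃ hs : (Hess u x).IsHermitian, ∑ i, Real.arctan (hs.eigenvalues i) = c) :
    ContDiffOn ℝ (⊤ : ℕ∞) (vv u c) U := by
  apply ContDiffOn.log
  · have h : ContDiffOn ℝ (⊤ : ℕ∞) (fun x => Complex.exp (-(c * Complex.I)) *
        (1 + Complex.I • (Hess u x).map Complex.ofReal).det) U := by
      apply contDiffOn_const.mul
      simp only [Matrix.det_apply']
      refine ContDiffOn.sum fun σ _ => contDiffOn_const.mul (contDiffOn_prod fun i _ => ?_)
      simp only [Matrix.add_apply, Matrix.smul_apply, Matrix.map_apply, smul_eq_mul]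
      exact contDiffOn_const.add (contDiffOn_const.mul
        (Complex.ofRealCLM.contDiff.comp_contDiffOn (Hess_smooth hU hu _ _)))
    exact Complex.reCLM.contDiff.comp_contDiffOn h
  · intro x hx
    obtain ⟨h1, h2⟩ := hs x hx
    rw [vv_eq hU hu c hx h1 h2]
    exact (prod_pos' _).ne'

lemma hom_two {u : E → ℝ}
    (hhom : ∀ x : E, x ≠ 0 → u x = ‖x‖ ^ 2 * u (‖x‖⁻¹ • x)) {s : ℝ} (hs : 0 < s) {x : E}
    (hx : x ≠ 0) : u (s • x) = s ^ 2 * u x := by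
  have hx' : ‖x‖ ≠ 0 := norm_ne_zero_iff.2 hx
  rw [hhom (s • x) (smul_ne_zero hs.ne' hx), hhom x hx, norm_smul, Real.norm_of_nonneg hs.le,
    smul_smul, mul_inv, mul_assoc s⁻¹, mul_comm ‖x‖⁻¹, ← mul_assoc s⁻¹, inv_mul_cancel₀ hs.ne',
    one_mul]
  ring

lemma Hess_hom {u : E → ℝ} (hu : ContDiffOn ℝ (⊤ : ℕ∞) u {(0 : E)}ᶜ)
    (hhom : ∀ x : E, x ≠ 0 → u x = ‖x‖ ^ 2 * u (‖x‖⁻¹ • x)) {s : ℝ} (hs : 0 < s) {x : E}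
    (hx : x ≠ 0) : Hess u (s • x) = Hess u x := by
  have hU : IsOpen ({(0 : E)}ᶜ) := isOpen_compl_singleton
  ext i j
  rw [Hess_eq_dd hU hu (smul_ne_zero hs.ne' hx), Hess_eq_dd hU hu hx]
  have h1 := dd_hom hs 1 hu (fun x hx => hom_two hhom hs hx) (EuclideanSpace.single j 1)
  have h2 := dd_hom hs 0 (dd_smooth hU hu (EuclideanSpace.single j 1)) h1
    (EuclideanSpace.single i 1) x hx
  simpa using h2

lemma vv_max (hn : 2 ≤ n) {u : E → ℝ} (hu : ContDiffOn ℝ (⊤ : ℕ∞) u {(0 : E)}ᶜ)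
    (hhom : ∀ x : E, x ≠ 0 → u x = ‖x‖ ^ 2 * u (‖x‖⁻¹ • x)) (c : ℝ)
    (hv : ContinuousOn (vv u c) {(0:E)}ᶜ) :
    ∃ x0 : E, x0 ≠ 0 ∧ ∀ x ≠ 0, vv u c x ≤ vv u c x0 := by
  have : Nontrivial (Fin n) := Fin.nontrivial_iff_two_le.2 hn
  have hne : (Metric.sphere (0:E) 1).Nonempty := by
    refine ⟨EuclideanSpace.single ⟨0, by omega⟩ 1, by simp⟩
  have hsub : Metric.sphere (0:E) 1 ⊆ {(0:E)}ᶜ := by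
    intro y hy h0
    simp only [Set.mem_singleton_iff] at h0
    subst h0
    simp at hy
  obtain ⟨x0, hx0, hmax⟩ := (isCompact_sphere (0:E) 1).exists_isMaxOn hne (hv.mono hsub)
  refine ⟨x0, hsub hx0, fun x hx => ?_⟩
  have hp : 0 < ‖x‖⁻¹ := inv_pos.2 (norm_pos_iff.2 hx)
  have h1 : vv u c (‖x‖⁻¹ • x) = vv u c x := by
    rw [vv, Hess_hom hu hhom hp hx, ← vv]
  rw [← h1]
  apply hmax
  simp [norm_smul, norm_ne_zero_iff.2 hx]

end main


section main2
variable {n : ℕ}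
local notation "E" => EuclideanSpace ℝ (Fin n)

lemma dd_sum {ι : Type*} (s : Finset ι) {F : ι → E → ℝ} {x : E} (a : E)
    (h : ∀ i ∈ s, DifferentiableAt ℝ (F i) x) :
    dd a (fun y => ∑ i ∈ s, F i y) x = ∑ i ∈ s, dd a (F i) x := by
  simp only [dd]
  rw [fderiv_fun_sum h]
  simp

lemma dd_mul {f g : E → ℝ} {x : E} (a : E) (hf : DifferentiableAt ℝ f x)
    (hg : DifferentiableAt ℝ g x) :
    dd a (fun y => f y * g y) x = f x * dd a g x + g x * dd a f x := by
  simp only [dd]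
  rw [fderiv_fun_mul hf hg]
  simp

lemma dd_zero_of {f : E → ℝ} {U : Set E} (hU : IsOpen U) (C : ℝ) (h : ∀ x ∈ U, f x = C) (a : E) :
    ∀ x ∈ U, dd a f x = 0 := by
  intro x hx
  rw [dd_congr hU (g := fun _ => C) h a x hx]
  simp [dd]

lemma dd_zero_basis {f : E → ℝ} {x : E} (b : OrthonormalBasis (Fin n) ℝ E)
    (h : ∀ m, dd (b m) f x = 0) (a : E) : dd a f x = 0 := by
  simp only [dd] at h ⊢
  rw [← b.sum_repr a, map_sum]
  simp [h]

lemma traces_const {u v : E → ℝ} {U : Set E} (hU : IsOpen U) (hu : ContDiffOn ℝ (⊤ : ℕ∞) u U)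
    (hv : ContDiffOn ℝ (⊤ : ℕ∞) v U) (c M : ℝ)
    (hdet : ∀ x ∈ U, (1 + Complex.I • (Hess u x).map Complex.ofReal).det =
      Complex.exp (v x + c * Complex.I)) (hM : ∀ x ∈ U, v x = M)
    {x : E} (hx : x ∈ U) (b : OrthonormalBasis (Fin n) ℝ E) (lam : Fin n → ℝ)
    (hdiag : Mb b u x = Matrix.diagonal lam)
    (hcond : ∀ i j, 0 ≤ 3 + lam i ^ 2 + 2 * lam i * lam j) (a : E) :
    dd a (fun y => (Hess u y).trace) x = 0 ∧ dd a (fun y => (Hess u y * Hess u y).trace) x = 0 := by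
  obtain ⟨p1, p2⟩ := pointwise hU hu hv c hdet hx b lam hdiag
  have s2 : ∀ a a', ContDiffOn ℝ (⊤ : ℕ∞) (dd a (dd a' u)) U := fun a a' =>
    dd_smooth hU (dd_smooth hU hu a') a
  have d2 : ∀ a a', DifferentiableAt ℝ (dd a (dd a' u)) x := fun a a' =>
    smooth_diffAt hU (s2 a a') hx
  have hv0 : ∀ a a', dd a (dd a' v) x = 0 := fun a a' =>
    dd_zero_of hU 0 (dd_zero_of hU M hM a') a x hx
  simp only [hv0, mul_zero, Finset.sum_const_zero] at p2
  have hnn : ∀ m j k, 0 ≤ ((1 + lam m ^ 2)⁻¹ * (1 + lam j ^ 2)⁻¹ * (1 + lam k ^ 2)⁻¹) *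
      (3 + lam m * lam j + lam j * lam k + lam k * lam m) *
        dd (b m) (dd (b j) (dd (b k) u)) x ^ 2 := by
    intro m j k
    have := triple_nonneg (hcond m j) (hcond j m) (hcond m k) (hcond k m) (hcond j k) (hcond k j)
    positivity
  have hz : ∀ m j k, ((1 + lam m ^ 2)⁻¹ * (1 + lam j ^ 2)⁻¹ * (1 + lam k ^ 2)⁻¹) *
      (3 + lam m * lam j + lam j * lam k + lam k * lam m) *
        dd (b m) (dd (b j) (dd (b k) u)) x ^ 2 = 0 := by
    intro m j k
    have q0 : (∑ m, ∑ j, ∑ k, ((1 + lam m ^ 2)⁻¹ * (1 + lam j ^ 2)⁻¹ * (1 + lam k ^ 2)⁻¹) *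
      (3 + lam m * lam j + lam j * lam k + lam k * lam m) *
        dd (b m) (dd (b j) (dd (b k) u)) x ^ 2) = 0 := by linarith
    have q1 := (Finset.sum_eq_zero_iff_of_nonneg (fun m _ => Finset.sum_nonneg fun j _ =>
      Finset.sum_nonneg fun k _ => hnn m j k)).1 q0 m (Finset.mem_univ m)
    have q2 := (Finset.sum_eq_zero_iff_of_nonneg (fun j _ =>
      Finset.sum_nonneg fun k _ => hnn m j k)).1 q1 j (Finset.mem_univ j)
    exact (Finset.sum_eq_zero_iff_of_nonneg (fun k _ => hnn m j k)).1 q2 k (Finset.mem_univ k)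
  have hec := fun m => eq_case lam m (fun j => dd (b m) (dd (b j) (dd (b j) u)) x) hcond
    (by
      intro j
      have := hz m j j
      have hpos : (1 + lam m ^ 2)⁻¹ * (1 + lam j ^ 2)⁻¹ * (1 + lam j ^ 2)⁻¹ ≠ 0 := by positivity
      rw [mul_assoc] at this
      have := (mul_eq_zero.1 this).resolve_left hpos
      rw [← this]; ring) (p1 m)
  constructor
  · refine dd_zero_basis b (fun m => ?_) a
    have : ∀ y ∈ U, (Hess u y).trace = ∑ j, dd (b j) (dd (b j) u) y := by
      intro y hy
      rw [← trace_Mb hU hu hy b]; rfl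
    rw [dd_congr hU this _ x hx, dd_sum _ _ (fun j _ => d2 _ _)]
    exact (hec m).1
  · refine dd_zero_basis b (fun m => ?_) a
    have : ∀ y ∈ U, (Hess u y * Hess u y).trace =
        ∑ j, ∑ k, dd (b j) (dd (b k) u) y * dd (b k) (dd (b j) u) y := by
      intro y hy
      rw [← trace2_Mb hU hu hy b]; rfl
    rw [dd_congr hU this _ x hx, dd_sum _ _
      (fun j _ => DifferentiableAt.fun_sum fun k _ => (d2 _ _).fun_mul (d2 _ _))]
    have hd : ∀ j k, dd (b j) (dd (b k) u) x = if j = k then lam j else 0 := by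
      intro j k
      have := congrFun (congrFun hdiag j) k
      simpa [Mb, Matrix.diagonal_apply] using this
    have : ∀ j, dd (b m) (fun y => ∑ k, dd (b j) (dd (b k) u) y * dd (b k) (dd (b j) u) y) x =
        2 * (lam j * dd (b m) (dd (b j) (dd (b j) u)) x) := by
      intro j
      rw [dd_sum _ _ (fun k _ => (d2 _ _).fun_mul (d2 _ _))]
      simp_rw [dd_mul _ (d2 _ _) (d2 _ _), hd]
      rw [Finset.sum_eq_single j]
      · simp; ring
      · intro k _ hk
        simp [hk, hk.symm]
      · simp
    simp_rw [this, ← Finset.mul_sum]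
    rw [(hec m).2, mul_zero]

lemma Hess_const_aux {u : E → ℝ} {U : Set E} (hU : IsOpen U) (hu : ContDiffOn ℝ (⊤ : ℕ∞) u U)
    (h1 : ∀ x ∈ U, ∀ a, dd a (fun y => (Hess u y).trace) x = 0)
    (h2 : ∀ x ∈ U, ∀ a, dd a (fun y => (Hess u y * Hess u y).trace) x = 0)
    {x : E} (hx : x ∈ U) (i j : Fin n) (a : E) : dd a (fun y => Hess u y i j) x = 0 := by
  set e : Fin n → E := fun i => EuclideanSpace.single i 1 with he
  have s1 : ∀ a, ContDiffOn ℝ (⊤ : ℕ∞) (dd a u) U := fun a => dd_smooth hU hu a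
  have s2 : ∀ a a', ContDiffOn ℝ (⊤ : ℕ∞) (dd a (dd a' u)) U := fun a a' => dd_smooth hU (s1 a') a
  have s3 : ∀ a a' a'', ContDiffOn ℝ (⊤ : ℕ∞) (dd a (dd a' (dd a'' u))) U :=
    fun a a' a'' => dd_smooth hU (s2 a' a'') a
  have d2 : ∀ y ∈ U, ∀ a a', DifferentiableAt ℝ (dd a (dd a' u)) y := fun y hy a a' =>
    smooth_diffAt hU (s2 a a') hy
  have d3 : ∀ y ∈ U, ∀ a a' a'', DifferentiableAt ℝ (dd a (dd a' (dd a'' u))) y :=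
    fun y hy a a' a'' => smooth_diffAt hU (s3 a a' a'') hy
  have hH : ∀ y ∈ U, ∀ i j, Hess u y i j = dd (e i) (dd (e j) u) y := fun y hy i j =>
    Hess_eq_dd hU hu hy i j
  have ht : ∀ y ∈ U, (Hess u y).trace = ∑ k, dd (e k) (dd (e k) u) y := by
    intro y hy
    simp only [Matrix.trace, Matrix.diag_apply, hH y hy]
  have hs : ∀ y ∈ U, (Hess u y * Hess u y).trace =
      ∑ i, ∑ j, dd (e i) (dd (e j) u) y * dd (e i) (dd (e j) u) y := by
    intro y hy
    simp only [Matrix.trace, Matrix.diag_apply, Matrix.mul_apply, hH y hy]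
    refine Finset.sum_congr rfl fun i _ => Finset.sum_congr rfl fun j _ => ?_
    rw [dd_comm hU hu (e j) (e i) y hy]
  -- first derivative of the trace in direction `e j`
  have t1 : ∀ a, ∀ y ∈ U, ∑ k, dd a (dd (e k) (dd (e k) u)) y = 0 := by
    intro a y hy
    rw [← dd_sum _ _ (fun k _ => d2 y hy _ _), ← dd_congr hU ht a y hy]
    exact h1 y hy a
  have t2 : ∀ a a', ∑ k, dd a (dd a' (dd (e k) (dd (e k) u))) x = 0 := by
    intro a a'
    rw [← dd_sum _ _ (fun k _ => d3 x hx _ _ _)]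
    exact dd_zero_of hU 0 (t1 a') a x hx
  have sw : ∀ k i j, dd (e k) (dd (e k) (dd (e i) (dd (e j) u))) x =
      dd (e i) (dd (e j) (dd (e k) (dd (e k) u))) x := by
    intro k i j
    have c1 : ∀ y ∈ U, dd (e k) (dd (e i) (dd (e j) u)) y = dd (e i) (dd (e j) (dd (e k) u)) y := by
      intro y hy
      rw [dd_comm hU (s1 _) _ _ y hy]
      exact dd_congr hU (dd_comm hU hu _ _) _ y hy
    have c2 : ∀ y ∈ U, dd (e k) (dd (e j) (dd (e k) u)) y = dd (e j) (dd (e k) (dd (e k) u)) y :=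
      fun y hy => dd_comm hU (s1 _) _ _ y hy
    rw [dd_congr hU c1 _ x hx, dd_comm hU (s2 _ _) _ _ x hx]
    exact dd_congr hU c2 _ x hx
  have g1 : ∀ k, ∀ y ∈ U, ∑ i, ∑ j,
      dd (e i) (dd (e j) u) y * dd (e k) (dd (e i) (dd (e j) u)) y = 0 := by
    intro k y hy
    have := h2 y hy (e k)
    rw [dd_congr hU hs _ y hy, dd_sum _ _ (fun i _ => DifferentiableAt.fun_sum fun j _ =>
      (d2 y hy _ _).fun_mul (d2 y hy _ _))] at this
    have e1 : ∀ i, dd (e k) (fun y => ∑ j, dd (e i) (dd (e j) u) y * dd (e i) (dd (e j) u) y) y =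
        2 * ∑ j, dd (e i) (dd (e j) u) y * dd (e k) (dd (e i) (dd (e j) u)) y := by
      intro i
      rw [dd_sum _ _ (fun j _ => (d2 y hy _ _).fun_mul (d2 y hy _ _)), Finset.mul_sum]
      refine Finset.sum_congr rfl fun j _ => ?_
      rw [dd_mul _ (d2 y hy _ _) (d2 y hy _ _)]
      ring
    simp_rw [e1, ← Finset.mul_sum] at this
    linarith
  have g2 : ∀ k, ∑ i, ∑ j,
      (dd (e i) (dd (e j) u) x * dd (e k) (dd (e k) (dd (e i) (dd (e j) u))) x +
      dd (e k) (dd (e i) (dd (e j) u)) x * dd (e k) (dd (e i) (dd (e j) u)) x) = 0 := by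
    intro k
    have := dd_zero_of hU 0 (g1 k) (e k) x hx
    rw [dd_sum _ _ (fun i _ => DifferentiableAt.fun_sum fun j _ =>
      (d2 x hx _ _).fun_mul (d3 x hx _ _ _))] at this
    rw [← this]
    refine Finset.sum_congr rfl fun i _ => ?_
    rw [dd_sum _ _ (fun j _ => (d2 x hx _ _).fun_mul (d3 x hx _ _ _))]
    refine Finset.sum_congr rfl fun j _ => ?_
    rw [dd_mul _ (d2 x hx _ _) (d3 x hx _ _ _)]
  have g3 : ∑ k, ∑ i, ∑ j, dd (e k) (dd (e i) (dd (e j) u)) x ^ 2 = 0 := by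
    have h0 : ∑ k, ∑ i, ∑ j,
        dd (e i) (dd (e j) u) x * dd (e k) (dd (e k) (dd (e i) (dd (e j) u))) x = 0 := by
      rw [Finset.sum_comm]
      refine Finset.sum_eq_zero fun i _ => ?_
      rw [Finset.sum_comm]
      refine Finset.sum_eq_zero fun j _ => ?_
      rw [← Finset.mul_sum]
      simp_rw [sw]
      rw [t2, mul_zero]
    have h3 := Finset.sum_congr (s₁ := (Finset.univ : Finset (Fin n))) rfl (fun k _ => g2 k)
    simp only [Finset.sum_add_distrib, Finset.sum_const_zero] at h3
    rw [h0, zero_add] at h3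
    simpa [sq] using h3
  have g4 : ∀ k, dd (e k) (dd (e i) (dd (e j) u)) x = 0 := by
    intro k
    have q1 := (Finset.sum_eq_zero_iff_of_nonneg (fun m _ => Finset.sum_nonneg fun j _ =>
      Finset.sum_nonneg fun k _ => sq_nonneg _)).1 g3 k (Finset.mem_univ k)
    have q2 := (Finset.sum_eq_zero_iff_of_nonneg (fun j _ =>
      Finset.sum_nonneg fun k _ => sq_nonneg _)).1 q1 i (Finset.mem_univ i)
    have q3 := (Finset.sum_eq_zero_iff_of_nonneg (fun k _ => sq_nonneg _)).1 q2 j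
      (Finset.mem_univ j)
    exact pow_eq_zero_iff (two_ne_zero) |>.1 q3
  rw [dd_congr hU (fun y hy => hH y hy i j) a x hx]
  refine dd_zero_basis (EuclideanSpace.basisFun (Fin n) ℝ) (fun m => ?_) a
  simpa using g4 m

lemma quad_of_hom {u : E → ℝ} (hu : ContDiffOn ℝ (⊤ : ℕ∞) u {(0 : E)}ᶜ)
    (hhom : ∀ x : E, x ≠ 0 → u x = ‖x‖ ^ 2 * u (‖x‖⁻¹ • x)) {x : E} (hx : x ≠ 0) :
    u x = (1 / 2) * ∑ i, ∑ j, Hess u x i j * x i * x j := by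
  have hU : IsOpen ({(0 : E)}ᶜ) := isOpen_compl_singleton
  have hxU : x ∈ ({(0 : E)}ᶜ : Set E) := hx
  rw [← dd_dd_Hess hU hu hxU]
  have e1 : ∀ y ∈ ({(0 : E)}ᶜ : Set E), dd y u y = 2 * u y := by
    intro y hy
    have h1 := dd_line (f := u) (x := y) (b := y) (t := 0) (smooth_diffAt hU hu (by simpa using hy))
    have h2 : HasDerivAt (fun s : ℝ => (1 + s) ^ 2 * u y) (2 * u y) 0 := by
      have := (((hasDerivAt_id (0:ℝ)).const_add 1).pow 2).mul_const (u y)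
      simpa using this
    have h3 : (fun s : ℝ => u (y + s • y)) =ᶠ[nhds 0] fun s => (1 + s) ^ 2 * u y := by
      filter_upwards [lt_mem_nhds (show (-1:ℝ) < 0 by norm_num)] with s hs
      rw [← hom_two hhom (by linarith) hy, add_smul, one_smul]
    have := h1.unique (h2.congr_of_eventuallyEq h3)
    simpa using this
  have h1 := dd_line (f := dd x u) (x := x) (b := x) (t := 0)
    (smooth_diffAt hU (dd_smooth hU hu x) (by simpa using hx))
  have h2 : HasDerivAt (fun s : ℝ => (1 + s) * dd x u x) (dd x u x) 0 := by
    have := ((hasDerivAt_id (0:ℝ)).const_add 1).mul_const (dd x u x)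
    simpa using this
  have h3 : (fun s : ℝ => dd x u (x + s • x)) =ᶠ[nhds 0] fun s => (1 + s) * dd x u x := by
    filter_upwards [lt_mem_nhds (show (-1:ℝ) < 0 by norm_num)] with s hs
    have hs' : 0 < 1 + s := by linarith
    have := dd_hom hs' 1 hu (fun x hx => hom_two hhom hs' hx) x x hx
    rw [add_smul, one_smul, pow_one] at this
    exact this
  have h4 := h1.unique (h2.congr_of_eventuallyEq h3)
  simp only [zero_smul, add_zero] at h4
  rw [h4, e1 x hxU]
  ring

end main2

/-- Homogeneous order-2 solutions away from the origin satisfying the weaker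
convexity constraint (3.1) are quadratic (Proposition 3.1). -/
theorem stmt_12 {n : ℕ} (hn : 2 ≤ n) (u : EuclideanSpace ℝ (Fin n) → ℝ) (c : ℝ)
    (hu : ContDiffOn ℝ (⊤ : ℕ∞) u {(0 : EuclideanSpace ℝ (Fin n))}ᶜ)
    (hhom : ∀ x : EuclideanSpace ℝ (Fin n), x ≠ 0 → u x = ‖x‖ ^ 2 * u (‖x‖⁻¹ • x))
    (hsym : ∀ x : EuclideanSpace ℝ (Fin n), x ≠ 0 → (Hess u x).IsHermitian)
    (hsol : ∀ (x : EuclideanSpace ℝ (Fin n)) (hx : x ≠ 0),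
      ∑ i, Real.arctan ((hsym x hx).eigenvalues i) = c)
    (hcond : ∀ (x : EuclideanSpace ℝ (Fin n)) (hx : x ≠ 0), ∀ i j : Fin n,
      0 ≤ 3 + ((hsym x hx).eigenvalues i) ^ 2 +
        2 * (hsym x hx).eigenvalues i * (hsym x hx).eigenvalues j) :
    ∃ A : Matrix (Fin n) (Fin n) ℝ, A.IsSymm ∧
      (∀ x : EuclideanSpace ℝ (Fin n), x ≠ 0 → Hess u x = A) ∧
      ∀ x : EuclideanSpace ℝ (Fin n), x ≠ 0 →
        u x = (1 / 2) * ∑ i, ∑ j, A i j * x i * x j := by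
  have hU : IsOpen ({(0 : EuclideanSpace ℝ (Fin n))}ᶜ) := isOpen_compl_singleton
  have hUc : IsPreconnected ({(0 : EuclideanSpace ℝ (Fin n))}ᶜ : Set _) := by
    apply (isConnected_compl_singleton_of_one_lt_rank _ _).isPreconnected
    rw [← Module.finrank_eq_rank, finrank_euclideanSpace_fin]
    exact_mod_cast hn
  have hv := vv_smooth hU hu c (fun x hx => ⟨hsym x hx, hsol x hx⟩)
  have hdet : ∀ x ∈ ({(0 : EuclideanSpace ℝ (Fin n))}ᶜ : Set _),
      (1 + Complex.I • (Hess u x).map Complex.ofReal).det =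
      Complex.exp (vv u c x + c * Complex.I) := fun x hx =>
    vv_det hU hu c hx (hsym x hx) (hsol x hx)
  obtain ⟨x0, hx0, hmax⟩ := vv_max hn hu hhom c hv.continuousOn
  have hconst : ∀ x ∈ ({(0 : EuclideanSpace ℝ (Fin n))}ᶜ : Set _), vv u c x = vv u c x0 := by
    refine strong_max (vv u c) hU hUc hv ?_ (vv u c x0) hmax x0 hx0 rfl
    intro K hK _
    refine ⟨(Real.exp (2 * vv u c x0))⁻¹, inv_pos.2 (Real.exp_pos _), fun x hx => ?_⟩
    have hx' : x ≠ 0 := hK hx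
    refine ⟨(hsym x hx').eigenvectorBasis,
      fun k => (1 + (hsym x hx').eigenvalues k ^ 2)⁻¹, fun k => ⟨?_, ?_⟩, ?_⟩
    · apply inv_anti₀ (by positivity)
      refine (vv_eig hU hu c (hK hx) (hsym x hx') (hsol x hx') k).trans ?_
      exact Real.exp_le_exp.2 (by linarith [hmax x hx'])
    · exact inv_le_one_of_one_le₀ (by nlinarith [sq_nonneg ((hsym x hx').eigenvalues k)])
    · rw [(pointwise hU hu hv c hdet (hK hx) _ _ (Mb_diag hU hu (hK hx) (hsym x hx'))).2]
      refine mul_nonneg (by norm_num) (Finset.sum_nonneg fun m _ => Finset.sum_nonneg fun j _ =>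
        Finset.sum_nonneg fun k _ => ?_)
      have hc := hcond x hx'
      have := triple_nonneg (hc m j) (hc j m) (hc m k) (hc k m) (hc j k) (hc k j)
      positivity
  have htr := fun x (hx : x ∈ ({(0 : EuclideanSpace ℝ (Fin n))}ᶜ : Set _)) a =>
    traces_const hU hu hv c (vv u c x0) hdet hconst hx _ _ (Mb_diag hU hu hx (hsym x hx))
      (hcond x hx) a
  have hH0 : ∀ x ≠ 0, Hess u x = Hess u x0 := by
    intro x hx
    ext i j
    refine hU.is_const_of_fderiv_eq_zero hUc (f := fun y => Hess u y i j)
      ((Hess_smooth hU hu i j).differentiableOn (by simp)) ?_ hx hx0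
    intro y hy
    ext a
    exact Hess_const_aux hU hu (fun x hx a => (htr x hx a).1) (fun x hx a => (htr x hx a).2) hy i j a
  refine ⟨Hess u x0, ?_, hH0, ?_⟩
  · have := hsym x0 hx0
    rwa [Matrix.IsHermitian, Matrix.conjTranspose_eq_transpose_of_trivial] at this
  · intro x hx
    rw [← hH0 x hx]
    exact quad_of_hom hu hhom hx
end

section
/- Let u be a smooth solution to the special Lagrangian equation ∑_{i=1}^n arctan λᵢ(x) = c on an open set Ω ⊆ ℝⁿ. Then for every x ∈ Ω, ∑_{i,j=1}^n g^{ij}(x) · ∂ᵢ∂ⱼ(|∇u|²)(x) = 2 · tr( g(x)⁻¹ · D²u(x)² ), where g(x) = I + D²u(x)·D²u(x); in particular this quantity equals 2 ∑_{i=1}^n λᵢ(x)² / (1 + λᵢ(x)²). -/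
theorem aux_det_deriv {n : ℕ} (N : ℝ → Matrix (Fin n) (Fin n) ℂ) (N' : Matrix (Fin n) (Fin n) ℂ)
    (t : ℝ) (h : ∀ i j, HasDerivAt (fun s => N s i j) (N' i j) t) :
    HasDerivAt (fun s => (N s).det) ((N t).adjugate * N').trace t := by
  have h1 : HasDerivAt (fun s => (N s).det)
      (∑ σ : Equiv.Perm (Fin n), ((Equiv.Perm.sign σ : ℤ) : ℂ) *
        ∑ i, (∏ j ∈ Finset.univ.erase i, N t (σ j) j) • N' (σ i) i) t := by
    simp only [Matrix.det_apply']
    refine HasDerivAt.fun_sum fun σ _ => ?_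
    refine HasDerivAt.const_mul _ ?_
    exact HasDerivAt.fun_finsetProd fun i _ => h (σ i) i
  convert h1 using 1
  have h2 : ((N t).adjugate * N').trace = ∑ i, ((N t).updateCol i (fun k => N' k i)).det := by
    unfold Matrix.trace
    refine Finset.sum_congr rfl fun i _ => ?_
    rw [← Matrix.cramer_apply, Matrix.cramer_eq_adjugate_mulVec]
    rfl
  rw [h2]
  simp only [Matrix.det_apply', Finset.mul_sum]
  rw [Finset.sum_comm]
  refine Finset.sum_congr rfl fun σ _ => Finset.sum_congr rfl fun i _ => ?_
  congr 1
  rw [← Finset.mul_prod_erase _ _ (Finset.mem_univ i)]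
  simp only [Matrix.updateCol_self, smul_eq_mul]
  rw [mul_comm]
  congr 1
  refine Finset.prod_congr rfl fun j hj => ?_
  rw [Matrix.updateCol_ne (Finset.ne_of_mem_erase hj)]

theorem aux_factor (l : ℝ) : Complex.I - (l : ℂ) =
    ((Real.sqrt (1 + l ^ 2) : ℝ) : ℂ) * (Complex.I * Complex.exp ((Real.arctan l : ℝ) * Complex.I)) := by
  have hp : 0 < Real.sqrt (1 + l ^ 2) := Real.sqrt_pos.2 (by positivity)
  rw [Complex.exp_mul_I, ← Complex.ofReal_cos, ← Complex.ofReal_sin, Real.cos_arctan,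
    Real.sin_arctan]
  have : ((Real.sqrt (1 + l ^ 2) : ℝ) : ℂ) ≠ 0 := by exact_mod_cast hp.ne'
  push_cast
  field_simp
  linear_combination (-(l:ℂ)) * Complex.I_sq

theorem aux_det {n : ℕ} (A : Matrix (Fin n) (Fin n) ℝ) (hA : A.IsHermitian) :
    (Matrix.scalar (Fin n) Complex.I - A.map (Complex.ofRealHom)).det =
      ((∏ i, Real.sqrt (1 + hA.eigenvalues i ^ 2) : ℝ) : ℂ) *
        (Complex.I ^ n * Complex.exp ((∑ i, Real.arctan (hA.eigenvalues i) : ℝ) * Complex.I)) := by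
  rw [← Matrix.eval_charpoly, Matrix.charpoly_map, hA.charpoly_eq]
  simp only [Polynomial.map_prod, Polynomial.eval_prod, Polynomial.map_sub, Polynomial.map_X,
    Polynomial.map_C, Polynomial.eval_sub, Polynomial.eval_X, Polynomial.eval_C]
  have : ∀ i, Complex.I - Complex.ofRealHom (RCLike.ofReal (K := ℝ) (hA.eigenvalues i)) = _ :=
    fun i => aux_factor (hA.eigenvalues i)
  simp only [this, Finset.prod_mul_distrib]
  simp [← Complex.exp_sum, Finset.sum_mul]

theorem aux_unit {n : ℕ} (A : Matrix (Fin n) (Fin n) ℝ) (hA : A.IsHermitian) :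
    IsUnit (1 + A * A).det := by
  have h : (1 + A * A).PosDef := by
    have := Matrix.posSemidef_conjTranspose_mul_self A
    rw [hA.eq] at this
    exact Matrix.PosDef.one.add_posSemidef this
  exact h.det_pos.ne'.isUnit

theorem aux_trace {n : ℕ} (A : Matrix (Fin n) (Fin n) ℝ) (hA : A.IsHermitian) :
    ((1 + A * A)⁻¹ * (A * A)).trace =
      ∑ i, hA.eigenvalues i ^ 2 / (1 + hA.eigenvalues i ^ 2) := by
  set φ := Unitary.conjStarAlgAut ℝ _ hA.eigenvectorUnitary with hφ
  set D : Matrix (Fin n) (Fin n) ℝ := Matrix.diagonal hA.eigenvalues with hD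
  set E : Matrix (Fin n) (Fin n) ℝ :=
    Matrix.diagonal (fun i => 1 / (1 + hA.eigenvalues i ^ 2)) with hE
  have hAD : A = φ D := hA.spectral_theorem
  have hED : E * (1 + D * D) = 1 := by
    rw [hE, hD, Matrix.diagonal_mul_diagonal, ← Matrix.diagonal_one, Matrix.diagonal_add,
      Matrix.diagonal_mul_diagonal]
    congr 1
    funext i
    have : 1 + hA.eigenvalues i ^ 2 ≠ 0 := by positivity
    field_simp
  have hinv : (1 + A * A)⁻¹ = φ E := by
    apply Matrix.inv_eq_left_inv
    have : φ (E * (1 + D * D)) = φ 1 := by rw [hED]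
    simpa only [map_mul, map_add, map_one, ← hAD] using this
  have : (1 + A * A)⁻¹ * (A * A) = φ (E * (D * D)) := by
    rw [hinv, map_mul, map_mul, ← hAD]
  rw [this, hφ, Unitary.conjStarAlgAut_apply, Matrix.trace_mul_comm, ← mul_assoc]
  simp only [Unitary.coe_star_mul_self, one_mul]
  rw [hE, hD, Matrix.diagonal_mul_diagonal, Matrix.diagonal_mul_diagonal, Matrix.trace_diagonal]
  refine Finset.sum_congr rfl fun i _ => ?_
  ring

theorem aux_lin {n : ℕ} (A : ℝ → Matrix (Fin n) (Fin n) ℝ) (A' : Matrix (Fin n) (Fin n) ℝ) (c : ℝ)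
    (h : ∀ i j, HasDerivAt (fun s => A s i j) (A' i j) 0)
    (hs : ∀ᶠ s in nhds (0:ℝ), ∃ hA : (A s).IsHermitian, ∑ i, Real.arctan (hA.eigenvalues i) = c) :
    ((1 + A 0 * A 0)⁻¹ * A').trace = 0 := by
  set N : ℝ → Matrix (Fin n) (Fin n) ℂ := fun s =>
    Matrix.scalar (Fin n) Complex.I - (A s).map (Complex.ofRealHom) with hN
  set K : ℂ := Complex.I ^ n * Complex.exp ((c : ℝ) * Complex.I) with hK
  have hK0 : K ≠ 0 := mul_ne_zero (pow_ne_zero _ Complex.I_ne_zero) (Complex.exp_ne_zero _)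
  have hd : HasDerivAt (fun s => (N s).det) ((N 0).adjugate * (-(A'.map Complex.ofRealHom))).trace
      0 := by
    apply aux_det_deriv
    intro i j
    have := ((h i j).ofReal_comp).const_sub ((Matrix.scalar (Fin n) Complex.I) i j)
    exact this
  have him : HasDerivAt (fun s => ((N s).det / K).im) 
      (((N 0).adjugate * (-(A'.map Complex.ofRealHom))).trace / K).im 0 := by
    exact Complex.imCLM.hasFDerivAt.comp_hasDerivAt (0:ℝ) (hd.div_const K)
  have hdet : ∀ s, (∃ hA : (A s).IsHermitian, ∑ i, Real.arctan (hA.eigenvalues i) = c) →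
      ∃ r : ℝ, 0 < r ∧ (N s).det = r * K := by
    rintro s ⟨hA, hc⟩
    refine ⟨∏ i, Real.sqrt (1 + hA.eigenvalues i ^ 2), ?_, ?_⟩
    · exact Finset.prod_pos fun i _ => Real.sqrt_pos.2 (by positivity)
    · rw [hN, hK, ← hc]; exact aux_det _ hA
  have hz : (fun s => ((N s).det / K).im) =ᶠ[nhds 0] fun _ => 0 := by
    filter_upwards [hs] with s hs
    obtain ⟨r, -, hr⟩ := hdet s hs
    rw [hr, mul_div_cancel_right₀ _ hK0, Complex.ofReal_im]
  have h0 := him.unique ((hasDerivAt_const (0:ℝ) (0:ℝ)).congr_of_eventuallyEq hz)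
  obtain ⟨hA, hc⟩ := hs.self_of_nhds
  obtain ⟨r, hr0, hr⟩ := hdet 0 ⟨hA, hc⟩
  set G := (1 + A 0 * A 0)⁻¹ with hG
  have hGG : (1 + A 0 * A 0) * G = 1 := Matrix.mul_nonsing_inv _ (aux_unit _ hA)
  set f : Matrix (Fin n) (Fin n) ℝ →+* Matrix (Fin n) (Fin n) ℂ :=
    Complex.ofRealHom.mapMatrix with hf
  have hfG : (1 + f (A 0) * f (A 0)) * f G = 1 := by
    rw [← map_one f, ← map_mul, ← map_add, ← map_mul, hGG]
  have hN0 : N 0 = Complex.I • 1 - f (A 0) := by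
    rw [hN]; simp [hf, Matrix.smul_one_eq_diagonal]
  have hadj : (N 0).adjugate = (N 0).det • (-((Complex.I • 1 + f (A 0)) * f G)) := by
    have hNM : N 0 * (-((Complex.I • 1 + f (A 0)) * f G)) = 1 := by
      refine Eq.trans ?_ hfG
      rw [mul_neg, ← mul_assoc, ← neg_mul]
      congr 1
      rw [hN0]
      simp only [sub_mul, mul_add, smul_mul_assoc, mul_smul_comm, one_mul, mul_one, smul_sub,
        smul_smul, Complex.I_mul_I, neg_smul, one_smul]
      abel
    calc (N 0).adjugate = (N 0).adjugate * (N 0 * (-((Complex.I • 1 + f (A 0)) * f G))) := by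
          rw [hNM, mul_one]
      _ = _ := by rw [← mul_assoc, Matrix.adjugate_mul, smul_mul_assoc, one_mul]
  have hfm : A'.map Complex.ofRealHom = f A' := rfl
  have htr : ∀ B, (f B).trace = ((B.trace : ℝ) : ℂ) := by
    intro B; simp [hf, Matrix.trace]
  have : (N 0).adjugate * (-(A'.map Complex.ofRealHom)) =
      (N 0).det • (Complex.I • f (G * A') + f (A 0 * G * A')) := by
    rw [hadj, hfm, smul_mul_assoc, neg_mul_neg]
    simp only [map_mul, add_mul, smul_mul_assoc, one_mul]
  rw [this, Matrix.trace_smul, Matrix.trace_add, Matrix.trace_smul, htr, htr, hr, smul_eq_mul,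
    smul_eq_mul, mul_right_comm, mul_div_cancel_right₀ _ hK0] at h0
  simp only [Complex.mul_im, Complex.add_im, Complex.add_re, Complex.ofReal_re, Complex.ofReal_im,
    Complex.I_re, Complex.I_im, Complex.mul_re] at h0
  have h1 : r * (G * A').trace = 0 := by linarith
  exact (mul_eq_zero.1 h1).resolve_left hr0.ne'

theorem aux_hess {n : ℕ} (Ω : Set (EuclideanSpace ℝ (Fin n))) (hΩ : IsOpen Ω)
    (u : EuclideanSpace ℝ (Fin n) → ℝ) (hu : ContDiffOn ℝ (⊤ : ℕ∞) u Ω)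
    (x : EuclideanSpace ℝ (Fin n)) (hx : x ∈ Ω) :
    ContDiffAt ℝ (⊤ : ℕ∞) (fderiv ℝ u) x ∧
    (∀ i, ContDiffAt ℝ (⊤ : ℕ∞) (fun y => fderiv ℝ u y (EuclideanSpace.single i 1)) x) ∧
    (∀ i j, ContDiffAt ℝ (⊤ : ℕ∞) (fun y => Hess u y i j) x) ∧
    (∀ i j, Hess u x i j =
      fderiv ℝ (fun y => fderiv ℝ u y (EuclideanSpace.single j 1)) x (EuclideanSpace.single i 1)) := by
  have hux : ContDiffAt ℝ (⊤ : ℕ∞) u x := hu.contDiffAt (hΩ.mem_nhds hx)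
  have h1 : ContDiffAt ℝ (⊤ : ℕ∞) (fderiv ℝ u) x := hux.fderiv_right (by simp)
  have h2 : ContDiffAt ℝ (⊤ : ℕ∞) (fderiv ℝ (fderiv ℝ u)) x := h1.fderiv_right (by simp)
  have hH : ∀ y i j, Hess u y i j = fderiv ℝ (fderiv ℝ u) y (EuclideanSpace.single i 1)
      (EuclideanSpace.single j 1) := by
    intro y i j
    simp [Hess, iteratedFDeriv_two_apply]
  refine ⟨h1, fun i => h1.clm_apply contDiffAt_const, fun i j => ?_, fun i j => ?_⟩
  · simp only [hH]
    exact (h2.clm_apply contDiffAt_const).clm_apply contDiffAt_const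
  · have hd : DifferentiableAt ℝ (fderiv ℝ u) x := h1.differentiableAt (by simp)
    rw [hH, fderiv_clm_apply hd (differentiableAt_const _)]
    simp

/-- The key computation in the proof of Lemma 2.2:
`Δ_g |∇u|² = 2 tr(g⁻¹ (D²u)²) = 2 ∑ λᵢ²/(1 + λᵢ²)`. -/
theorem stmt_16 {n : ℕ} (hn : 2 ≤ n) (Ω : Set (EuclideanSpace ℝ (Fin n))) (hΩ : IsOpen Ω)
    (u : EuclideanSpace ℝ (Fin n) → ℝ) (c : ℝ)
    (hu : ContDiffOn ℝ (⊤ : ℕ∞) u Ω)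
    (hsym : ∀ x ∈ Ω, (Hess u x).IsHermitian)
    (hsol : ∀ x, ∀ hx : x ∈ Ω, ∑ i, Real.arctan ((hsym x hx).eigenvalues i) = c) :
    ∀ x, ∀ hx : x ∈ Ω,
      lapg u (fun y => ∑ k, fderiv ℝ u y (EuclideanSpace.single k 1) ^ 2) x =
          2 * Matrix.trace ((gMat u x)⁻¹ * (Hess u x * Hess u x)) ∧
      lapg u (fun y => ∑ k, fderiv ℝ u y (EuclideanSpace.single k 1) ^ 2) x =
          2 * ∑ i, ((hsym x hx).eigenvalues i) ^ 2 /
            (1 + ((hsym x hx).eigenvalues i) ^ 2) := by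
  intro x hx
  have key : lapg u (fun y => ∑ k, fderiv ℝ u y (EuclideanSpace.single k 1) ^ 2) x =
          2 * Matrix.trace ((gMat u x)⁻¹ * (Hess u x * Hess u x)) := by
    set e : Fin n → EuclideanSpace ℝ (Fin n) := fun i => EuclideanSpace.single i 1 with he
    have hnear : ∀ᶠ y in nhds x, y ∈ Ω := hΩ.mem_nhds hx
    obtain ⟨-, hw, hHs, hHx⟩ := aux_hess Ω hΩ u hu x hx
    have hHd : ∀ i j, DifferentiableAt ℝ (fun y => Hess u y i j) x :=
      fun i j => (hHs i j).differentiableAt (by simp)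
    have hwd : ∀ i, DifferentiableAt ℝ (fun y => fderiv ℝ u y (e i)) x :=
      fun i => (hw i).differentiableAt (by simp)
    have hsy : ∀ y ∈ Ω, ∀ i j, Hess u y i j = Hess u y j i := by
      intro y hy i j
      have := (hsym y hy).apply i j
      simpa using this.symm
    -- third derivatives are symmetric
    have hthird : ∀ i j k, fderiv ℝ (fun y => Hess u y j k) x (e i) =
        fderiv ℝ (fun y => Hess u y i j) x (e k) := by
      intro i j k
      have hE : ∀ k, (fun y => Hess u y k j) =ᶠ[nhds x]
          (fun y => fderiv ℝ (fun z => fderiv ℝ u z (e j)) y (e k)) := by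
        intro k
        filter_upwards [hnear] with y hy
        exact (aux_hess Ω hΩ u hu y hy).2.2.2 k j
      have hS : (fun y => Hess u y j k) =ᶠ[nhds x] (fun y => Hess u y k j) := by
        filter_upwards [hnear] with y hy
        exact hsy y hy j k
      have hd : DifferentiableAt ℝ (fderiv ℝ (fun z => fderiv ℝ u z (e j))) x :=
        ((hw j).fderiv_right (m := (⊤ : ℕ∞)) (by simp)).differentiableAt (by simp)
      have hsm : IsSymmSndFDerivAt ℝ (fun z => fderiv ℝ u z (e j)) x :=
        ((hw j).of_le (m := 2) (WithTop.coe_le_coe.2 (le_top : (2 : ℕ∞) ≤ ⊤))).isSymmSndFDerivAt (by simp)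
      rw [hS.fderiv_eq, (hE k).fderiv_eq, (hE i).fderiv_eq,
        fderiv_clm_apply hd (differentiableAt_const _),
        fderiv_clm_apply hd (differentiableAt_const _)]
      simpa using hsm (e i) (e k)
    -- harmonicity of the partial derivatives
    have hharm : ∀ k, ∑ i, ∑ j, (gMat u x)⁻¹ i j * fderiv ℝ (fun y => Hess u y i j) x (e k) = 0 := by
      intro k
      have hline : HasDerivAt (fun t : ℝ => x + t • e k) (e k) 0 := by
        simpa using ((hasDerivAt_id (0:ℝ)).smul_const (e k)).const_add x
      have hx0 : x + (0:ℝ) • e k = x := by simp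
      have h := aux_lin (fun t : ℝ => Hess u (x + t • e k))
        (Matrix.of fun i j => fderiv ℝ (fun y => Hess u y i j) x (e k)) c ?_ ?_
      · simp only [hx0] at h
        rw [← h]
        unfold Matrix.trace
        refine Finset.sum_congr rfl fun i _ => ?_
        rw [Matrix.diag_apply, Matrix.mul_apply]
        refine Finset.sum_congr rfl fun j _ => ?_
        have hS : (fun y => Hess u y i j) =ᶠ[nhds x] (fun y => Hess u y j i) := by
          filter_upwards [hnear] with y hy
          exact hsy y hy i j
        rw [Matrix.of_apply, hS.fderiv_eq]
        rfl
      · intro i j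
        have h1 : HasFDerivAt (fun y => Hess u y i j) (fderiv ℝ (fun y => Hess u y i j) x)
            (x + (0:ℝ) • e k) := by rw [hx0]; exact (hHd i j).hasFDerivAt
        exact h1.comp_hasDerivAt (0:ℝ) hline
      · have : Filter.Tendsto (fun t : ℝ => x + t • e k) (nhds 0) (nhds x) := by
          have := hline.continuousAt.tendsto
          rwa [hx0] at this
        filter_upwards [this.eventually hnear] with t ht
        exact ⟨hsym _ ht, hsol _ ht⟩
    -- second derivatives of the squared gradient
    have hsecond : ∀ i j, iteratedFDeriv ℝ 2
        (fun y => ∑ k, fderiv ℝ u y (e k) ^ 2) x ![e i, e j] =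
        ∑ k, (2 * (Hess u x i k * Hess u x j k) +
          2 * (fderiv ℝ u x (e k) * fderiv ℝ (fun y => Hess u y i j) x (e k))) := by
      intro i j
      have hfd : ∀ y ∈ Ω, fderiv ℝ (fun y => ∑ k, fderiv ℝ u y (e k) ^ 2) y (e j) =
          ∑ k, 2 * (fderiv ℝ u y (e k) * Hess u y j k) := by
        intro y hy
        obtain ⟨-, hw', -, hHy⟩ := aux_hess Ω hΩ u hu y hy
        have : HasFDerivAt (fun y => ∑ k, fderiv ℝ u y (e k) ^ 2)
            (∑ k, (2 * fderiv ℝ u y (e k) ^ 1) • fderiv ℝ (fun z => fderiv ℝ u z (e k)) y) y := by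
          refine HasFDerivAt.fun_sum fun k _ => ?_
          have hk : HasFDerivAt (fun z => fderiv ℝ u z (e k)) _ y :=
            ((hw' k).differentiableAt (by simp)).hasFDerivAt
          simpa using hk.pow 2
        rw [this.fderiv, ContinuousLinearMap.sum_apply]
        refine Finset.sum_congr rfl fun k _ => ?_
        rw [hHy j k]
        simp only [ContinuousLinearMap.smul_apply, smul_eq_mul, pow_one, he]
        ring
      have hC : ContDiffAt ℝ (⊤ : ℕ∞) (fun y => ∑ k, fderiv ℝ u y (e k) ^ 2) x :=
        ContDiffAt.sum fun k _ => (hw k).pow 2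
      have hd : DifferentiableAt ℝ (fderiv ℝ (fun y => ∑ k, fderiv ℝ u y (e k) ^ 2)) x :=
        (hC.fderiv_right (m := (⊤ : ℕ∞)) (by simp)).differentiableAt (by simp)
      have h1 : iteratedFDeriv ℝ 2 (fun y => ∑ k, fderiv ℝ u y (e k) ^ 2) x ![e i, e j] =
          fderiv ℝ (fun y => fderiv ℝ (fun y => ∑ k, fderiv ℝ u y (e k) ^ 2) y (e j)) x (e i) := by
        rw [iteratedFDeriv_two_apply, fderiv_clm_apply hd (differentiableAt_const _)]
        simp
      have h2 : (fun y => fderiv ℝ (fun y => ∑ k, fderiv ℝ u y (e k) ^ 2) y (e j)) =ᶠ[nhds x]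
          (fun y => ∑ k, 2 * (fderiv ℝ u y (e k) * Hess u y j k)) := by
        filter_upwards [hnear] with y hy
        exact hfd y hy
      have h3 : HasFDerivAt (fun y => ∑ k, 2 * (fderiv ℝ u y (e k) * Hess u y j k))
          (∑ k, (2:ℝ) • (fderiv ℝ u x (e k) • fderiv ℝ (fun y => Hess u y j k) x +
            Hess u x j k • fderiv ℝ (fun z => fderiv ℝ u z (e k)) x)) x := by
        refine HasFDerivAt.fun_sum fun k _ => ?_
        exact ((hwd k).hasFDerivAt.mul (hHd j k).hasFDerivAt).const_mul 2
      rw [h1, h2.fderiv_eq, h3.fderiv, ContinuousLinearMap.sum_apply]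
      refine Finset.sum_congr rfl fun k _ => ?_
      rw [← hthird i j k, hHx i k]
      simp only [ContinuousLinearMap.smul_apply, ContinuousLinearMap.add_apply, smul_eq_mul, he]
      ring
    have hl : lapg u (fun y => ∑ k, fderiv ℝ u y (e k) ^ 2) x =
        ∑ i, ∑ j, (gMat u x)⁻¹ i j * ∑ k, (2 * (Hess u x i k * Hess u x j k) +
          2 * (fderiv ℝ u x (e k) * fderiv ℝ (fun y => Hess u y i j) x (e k))) := by
      unfold lapg
      refine Finset.sum_congr rfl fun i _ => Finset.sum_congr rfl fun j _ => ?_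
      rw [← hsecond i j]
    rw [hl]
    have hsplit : ∑ i, ∑ j, (gMat u x)⁻¹ i j * ∑ k, (2 * (Hess u x i k * Hess u x j k) +
          2 * (fderiv ℝ u x (e k) * fderiv ℝ (fun y => Hess u y i j) x (e k))) =
        2 * (∑ i, ∑ j, (gMat u x)⁻¹ i j * ∑ k, Hess u x i k * Hess u x j k) +
        ∑ k, 2 * fderiv ℝ u x (e k) *
          ∑ i, ∑ j, (gMat u x)⁻¹ i j * fderiv ℝ (fun y => Hess u y i j) x (e k) := by
      have hc : ∑ k, 2 * fderiv ℝ u x (e k) *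
          ∑ i, ∑ j, (gMat u x)⁻¹ i j * fderiv ℝ (fun y => Hess u y i j) x (e k) =
          ∑ i, ∑ j, (gMat u x)⁻¹ i j * ∑ k,
            2 * (fderiv ℝ u x (e k) * fderiv ℝ (fun y => Hess u y i j) x (e k)) := by
        simp only [Finset.mul_sum]
        rw [Finset.sum_comm]
        refine Finset.sum_congr rfl fun i _ => ?_
        rw [Finset.sum_comm]
        refine Finset.sum_congr rfl fun j _ => Finset.sum_congr rfl fun k _ => ?_
        ring
      rw [hc, Finset.mul_sum, ← Finset.sum_add_distrib]
      refine Finset.sum_congr rfl fun i _ => ?_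
      rw [Finset.mul_sum, ← Finset.sum_add_distrib]
      refine Finset.sum_congr rfl fun j _ => ?_
      rw [Finset.sum_add_distrib, ← Finset.mul_sum]
      ring
    rw [hsplit]
    simp only [hharm, mul_zero, Finset.sum_const_zero, add_zero]
    congr 1
    unfold Matrix.trace
    refine Finset.sum_congr rfl fun i _ => ?_
    rw [Matrix.diag_apply, Matrix.mul_apply]
    refine Finset.sum_congr rfl fun j _ => ?_
    rw [Matrix.mul_apply]
    congr 1
    refine Finset.sum_congr rfl fun k _ => ?_
    rw [hsy x hx i k, mul_comm]
  refine ⟨key, ?_⟩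
  rw [key]
  congr 1
  exact aux_trace _ (hsym x hx)
end
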